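/- arXiv:2210.02014 — 13 statements merged into one kernel-verified Lean document; each statement's English description precedes it below -/
import Mathlib

section
/- Under Conditions (C1), (C4) and (C6), for every measurable function f : ℝ → ℝ such that f∘Y₋ ∈ L²(P) and f∘Y₊ ∈ L¹(P), one has E[q*(Z₋) · f(Y₋)] = E[f(Y₊)]. In particular (taking f the identity, when Y₋ ∈ L²(P) and Y₊ ∈ L¹(P)), the mean of the counterfactual untreated post-treatment outcome is identified as E[Y₊] = E[q*(Z₋) · Y₋]. -/
open MeasureTheory ProbabilityTheory MeasurableSpace

/-- **Identification of the counterfactual mean via the treatment confounding bridge.**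
Under proxy conditional independence (C1), covariate shift (C4), and the treatment
confounding bridge condition (C6), for every square-integrable transform `f` of the
pre-treatment outcome with `f ∘ Y₊` integrable, `E[q*(Z₋) f(Y₋)] = E[f(Y₊)]`. -/
theorem identification_ATT_via_treatment_bridge
    {Ω 𝒰 𝒲 𝒵 : Type*}
    [MeasurableSpace Ω] [StandardBorelSpace Ω] [Nonempty Ω]
    [MeasurableSpace 𝒰] [StandardBorelSpace 𝒰]
    [MeasurableSpace 𝒲] [StandardBorelSpace 𝒲] [Nonempty 𝒲]
    [MeasurableSpace 𝒵] [StandardBorelSpace 𝒵]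
    (P : Measure Ω) [IsProbabilityMeasure P]
    (Um Up : Ω → 𝒰) (Wm Wp : Ω → 𝒲) (Zm : Ω → 𝒵) (Ym Yp : Ω → ℝ)
    (hUm : Measurable Um) (hUp : Measurable Up)
    (hWm : Measurable Wm) (hWp : Measurable Wp)
    (hZm : Measurable Zm) (hYm : Measurable Ym) (hYp : Measurable Yp)
    -- Condition (C1): Z₋ ⫫ (Y₋, W₋) | σ(U₋)
    (hC1 : CondIndepFun (MeasurableSpace.comap Um inferInstance) hUm.comap_le
      Zm (fun ω => (Ym ω, Wm ω)) P)
    -- Condition (C4): covariate shift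
    (hC4 : ∀ᵐ u ∂(P.map Um),
      condDistrib (fun ω => (Ym ω, Wm ω)) Um P u
        = condDistrib (fun ω => (Yp ω, Wp ω)) Up P u)
    -- Condition (C6): treatment confounding bridge
    (qstar : 𝒵 → ℝ) (hqstar : Measurable qstar)
    (habs : P.map Up ≪ P.map Um)
    (hqL2 : MemLp (fun ω => qstar (Zm ω)) 2 P)
    (hbridge : P[(fun ω => qstar (Zm ω)) | MeasurableSpace.comap Um inferInstance]
      =ᵐ[P] fun ω => ((P.map Up).rnDeriv (P.map Um) (Um ω)).toReal)
    -- the transform f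
    (f : ℝ → ℝ) (hf : Measurable f)
    (hfYm : MemLp (fun ω => f (Ym ω)) 2 P)
    (hfYp : Integrable (fun ω => f (Yp ω)) P) :
    ∫ ω, qstar (Zm ω) * f (Ym ω) ∂P = ∫ ω, f (Yp ω) ∂P := by
  classical
  by_cases hZne : Nonempty 𝒵
  swap
  · obtain ⟨ω⟩ := ‹Nonempty Ω›
    exact absurd ⟨Zm ω⟩ hZne
  set V : Ω → ℝ × 𝒲 := fun ω => (Ym ω, Wm ω) with hV
  set V' : Ω → ℝ × 𝒲 := fun ω => (Yp ω, Wp ω) with hV'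
  have hVm : Measurable V := hYm.prodMk hWm
  have hVp : Measurable V' := hYp.prodMk hWp
  have hUZ : Measurable (fun ω => (Um ω, Zm ω)) := hUm.prodMk hZm
  have hF : StronglyMeasurable (fun v : ℝ × 𝒲 => f v.1) :=
    (hf.comp measurable_fst).stronglyMeasurable
  set g : 𝒰 → ℝ := fun u => ∫ v, f v.1 ∂(condDistrib V Um P u) with hg
  have hgm : StronglyMeasurable g := by
    have := StronglyMeasurable.integral_condDistrib (X := Um) (Y := V) (μ := P)
      (f := fun x : 𝒰 × (ℝ × 𝒲) => f x.2.1) (by fun_prop)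
    exact this
  have hfi : Integrable (fun ω => f (Ym ω)) P := hfYm.integrable (by norm_num)
  have hqi : Integrable (fun ω => qstar (Zm ω)) P := hqL2.integrable (by norm_num)
  have e1 : P[fun ω => f (Ym ω) | MeasurableSpace.comap Um inferInstance]
      =ᵐ[P] fun ω => g (Um ω) :=
    condExp_ae_eq_integral_condDistrib (Y := V) hUm hVm.aemeasurable hF hfi
  have e2 : P[fun ω => f (Ym ω) | MeasurableSpace.comap (fun ω => (Um ω, Zm ω)) inferInstance]
      =ᵐ[P] fun ω => ∫ v, f v.1 ∂(condDistrib V (fun ω => (Um ω, Zm ω)) P (Um ω, Zm ω)) :=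
    condExp_ae_eq_integral_condDistrib (Y := V) hUZ hVm.aemeasurable hF hfi
  have hci := (condIndepFun_iff_condDistrib_prod_ae_eq_prodMkRight hVm hZm hUm).1 hC1
  have e3 : P[fun ω => f (Ym ω) | MeasurableSpace.comap (fun ω => (Um ω, Zm ω)) inferInstance]
      =ᵐ[P] fun ω => g (Um ω) := by
    filter_upwards [e2, ae_of_ae_map hUZ.aemeasurable hci] with ω h1 h2
    rw [h1, h2]
    simp [hg]
  have hgL2 : MemLp (fun ω => g (Um ω)) 2 P :=
    (memLp_congr_ae e1).1 (hfYm.condExp (by norm_num))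
  have hqf : Integrable (fun ω => qstar (Zm ω) * f (Ym ω)) P := hqL2.integrable_mul hfYm
  have hqg : Integrable (fun ω => qstar (Zm ω) * g (Um ω)) P := hqL2.integrable_mul hgL2
  have s1 : ∫ ω, qstar (Zm ω) * f (Ym ω) ∂P = ∫ ω, qstar (Zm ω) * g (Um ω) ∂P := by
    rw [← integral_condExp hUZ.comap_le]
    apply integral_congr_ae
    have hq' : StronglyMeasurable[MeasurableSpace.comap (fun ω => (Um ω, Zm ω)) inferInstance]
        (fun ω => qstar (Zm ω)) :=
      ((hqstar.comp measurable_snd).comp (comap_measurable _)).stronglyMeasurable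
    have := condExp_mul_of_stronglyMeasurable_left (μ := P) hq' hqf hfi
    filter_upwards [this, e3] with ω h1 h2
    refine h1.trans ?_
    simp [h2]
  have s2 : ∫ ω, qstar (Zm ω) * g (Um ω) ∂P
      = ∫ ω, ((P.map Up).rnDeriv (P.map Um) (Um ω)).toReal * g (Um ω) ∂P := by
    rw [← integral_condExp hUm.comap_le]
    apply integral_congr_ae
    have hg' : StronglyMeasurable[MeasurableSpace.comap Um inferInstance]
        (fun ω => g (Um ω)) := hgm.comp_measurable (comap_measurable _)
    have := condExp_mul_of_stronglyMeasurable_right (μ := P) hg' hqg hqi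
    filter_upwards [this, hbridge] with ω h1 h2
    refine h1.trans ?_
    simp [h2]
  have : IsProbabilityMeasure (P.map Up) := Measure.isProbabilityMeasure_map hUp.aemeasurable
  have : IsProbabilityMeasure (P.map Um) := Measure.isProbabilityMeasure_map hUm.aemeasurable
  have s3 : ∫ ω, ((P.map Up).rnDeriv (P.map Um) (Um ω)).toReal * g (Um ω) ∂P
      = ∫ u, g u ∂(P.map Up) := by
    rw [← integral_rnDeriv_smul habs, integral_map hUm.aemeasurable]
    · rfl
    · exact ((Measure.measurable_rnDeriv _ _).ennreal_toReal.stronglyMeasurable.smul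
        hgm).aestronglyMeasurable
  have e4 : P[fun ω => f (Yp ω) | MeasurableSpace.comap Up inferInstance]
      =ᵐ[P] fun ω => ∫ v, f v.1 ∂(condDistrib V' Up P (Up ω)) :=
    condExp_ae_eq_integral_condDistrib (Y := V') hUp hVp.aemeasurable hF hfYp
  have s4 : ∫ u, g u ∂(P.map Up) = ∫ ω, f (Yp ω) ∂P := by
    rw [integral_map hUp.aemeasurable hgm.aestronglyMeasurable, 
      ← integral_condExp hUp.comap_le (f := fun ω => f (Yp ω))]
    apply integral_congr_ae
    filter_upwards [e4, ae_of_ae_map hUp.aemeasurable (habs.ae_le hC4)] with ω h1 h2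
    rw [h1, ← h2]
  rw [s1, s2, s3, s4]
end

section
/- Under Conditions (C1), (C4) and (C6), the law of the post-treatment proxy is absolutely continuous with respect to the law of the pre-treatment proxy: P∘W₊⁻¹ ≪ P∘W₋⁻¹. -/
open MeasureTheory ProbabilityTheory MeasurableSpace

/-- Under Conditions (C1), (C4) and (C6), the law of the post-treatment proxy `W₊` is\nabsolutely continuous with respect to the law of the pre-treatment proxy `W₋`. -/
theorem absolutelyContinuous_map_proxy
    {Ω 𝒰 𝒲 𝒵 : Type*}
    [MeasurableSpace Ω] [StandardBorelSpace Ω] [Nonempty Ω]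
    [MeasurableSpace 𝒰] [StandardBorelSpace 𝒰]
    [MeasurableSpace 𝒲] [StandardBorelSpace 𝒲] [Nonempty 𝒲]
    [MeasurableSpace 𝒵] [StandardBorelSpace 𝒵]
    (P : Measure Ω) [IsProbabilityMeasure P]
    (Um Up : Ω → 𝒰) (Wm Wp : Ω → 𝒲) (Zm : Ω → 𝒵) (Ym Yp : Ω → ℝ)
    (hUm : Measurable Um) (hUp : Measurable Up)
    (hWm : Measurable Wm) (hWp : Measurable Wp)
    (hZm : Measurable Zm) (hYm : Measurable Ym) (hYp : Measurable Yp)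
    -- Condition (C1): Z₋ ⫫ (Y₋, W₋) | σ(U₋)
    (hC1 : CondIndepFun (MeasurableSpace.comap Um inferInstance) hUm.comap_le
      Zm (fun ω => (Ym ω, Wm ω)) P)
    -- Condition (C4): covariate shift
    (hC4 : ∀ᵐ u ∂(P.map Um),
      condDistrib (fun ω => (Ym ω, Wm ω)) Um P u
        = condDistrib (fun ω => (Yp ω, Wp ω)) Up P u)
    -- Condition (C6): treatment confounding bridge
    (qstar : 𝒵 → ℝ) (hqstar : Measurable qstar)
    (habs : P.map Up ≪ P.map Um)
    (hqL2 : MemLp (fun ω => qstar (Zm ω)) 2 P)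
    (hbridge : P[(fun ω => qstar (Zm ω)) | MeasurableSpace.comap Um inferInstance]
      =ᵐ[P] fun ω => ((P.map Up).rnDeriv (P.map Um) (Um ω)).toReal) :
    P.map Wp ≪ P.map Wm := by
  have h1 : P.map (fun ω => (Yp ω, Wp ω)) ≪ P.map (fun ω => (Ym ω, Wm ω)) := by
    rw [← condDistrib_comp_map (μ := P) hUp.aemeasurable (hYp.prodMk hWp).aemeasurable,
      ← condDistrib_comp_map (μ := P) hUm.aemeasurable (hYm.prodMk hWm).aemeasurable,
      ← Measure.bind_congr_right (habs.ae_le hC4)]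
    exact habs.comp_right _
  have h2 := h1.map (f := Prod.snd) measurable_snd
  rw [Measure.map_map measurable_snd (hYp.prodMk hWp),
    Measure.map_map measurable_snd (hYm.prodMk hWm)] at h2
  exact h2
end

section
/- Under Conditions (C1), (C4) and (C6) (which imply P∘W₊⁻¹ ≪ P∘W₋⁻¹), the treatment confounding bridge function q* solves the integral equation in the observed proxies: P-almost surely, E[q*(Z₋) | σ(W₋)] = (d(P∘W₊⁻¹)/d(P∘W₋⁻¹)) ∘ W₋. -/
open MeasureTheory ProbabilityTheory MeasurableSpace

/-- Under Conditions (C1), (C4) and (C6), the treatment confounding bridge `q*` solves the\nintegral equation `E[q*(Z₋) | σ(W₋)] = (dP_{W₊}/dP_{W₋}) ∘ W₋` in the observed proxies. -/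
theorem treatment_bridge_solves_proxy_integral_equation
    {Ω 𝒰 𝒲 𝒵 : Type*}
    [MeasurableSpace Ω] [StandardBorelSpace Ω] [Nonempty Ω]
    [MeasurableSpace 𝒰] [StandardBorelSpace 𝒰]
    [MeasurableSpace 𝒲] [StandardBorelSpace 𝒲] [Nonempty 𝒲]
    [MeasurableSpace 𝒵] [StandardBorelSpace 𝒵]
    (P : Measure Ω) [IsProbabilityMeasure P]
    (Um Up : Ω → 𝒰) (Wm Wp : Ω → 𝒲) (Zm : Ω → 𝒵) (Ym Yp : Ω → ℝ)
    (hUm : Measurable Um) (hUp : Measurable Up)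
    (hWm : Measurable Wm) (hWp : Measurable Wp)
    (hZm : Measurable Zm) (hYm : Measurable Ym) (hYp : Measurable Yp)
    -- Condition (C1): Z₋ ⫫ (Y₋, W₋) | σ(U₋)
    (hC1 : CondIndepFun (MeasurableSpace.comap Um inferInstance) hUm.comap_le
      Zm (fun ω => (Ym ω, Wm ω)) P)
    -- Condition (C4): covariate shift
    (hC4 : ∀ᵐ u ∂(P.map Um),
      condDistrib (fun ω => (Ym ω, Wm ω)) Um P u
        = condDistrib (fun ω => (Yp ω, Wp ω)) Up P u)
    -- Condition (C6): treatment confounding bridge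
    (qstar : 𝒵 → ℝ) (hqstar : Measurable qstar)
    (habs : P.map Up ≪ P.map Um)
    (hqL2 : MemLp (fun ω => qstar (Zm ω)) 2 P)
    (hbridge : P[(fun ω => qstar (Zm ω)) | MeasurableSpace.comap Um inferInstance]
      =ᵐ[P] fun ω => ((P.map Up).rnDeriv (P.map Um) (Um ω)).toReal) :
    P[(fun ω => qstar (Zm ω)) | MeasurableSpace.comap Wm inferInstance]
      =ᵐ[P] fun ω => ((P.map Wp).rnDeriv (P.map Wm) (Wm ω)).toReal := by
  have : Nonempty 𝒵 := ⟨Zm (Classical.arbitrary Ω)⟩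
  have hVm : Measurable (fun ω => (Ym ω, Wm ω)) := hYm.prodMk hWm
  have hVp : Measurable (fun ω => (Yp ω, Wp ω)) := hYp.prodMk hWp
  have hX : Measurable (fun ω => (Um ω, (Ym ω, Wm ω))) := hUm.prodMk hVm
  have hqi : Integrable (fun ω => qstar (Zm ω)) P := hqL2.integrable (by norm_num)
  have : IsProbabilityMeasure (P.map Um) := Measure.isProbabilityMeasure_map hUm.aemeasurable
  have : IsProbabilityMeasure (P.map Up) := Measure.isProbabilityMeasure_map hUp.aemeasurable
  have : IsProbabilityMeasure (P.map Wm) := Measure.isProbabilityMeasure_map hWm.aemeasurable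
  have : IsProbabilityMeasure (P.map Wp) := Measure.isProbabilityMeasure_map hWp.aemeasurable
  -- conditional expectation given (U, V) agrees with the density in U
  have hUV : P[(fun ω => qstar (Zm ω)) |
      MeasurableSpace.comap (fun ω => (Um ω, (Ym ω, Wm ω))) inferInstance]
      =ᵐ[P] fun ω => ((P.map Up).rnDeriv (P.map Um) (Um ω)).toReal := by
    have h1 := (condIndepFun_iff_condDistrib_prod_ae_eq_prodMkRight hZm hVm hUm).1 hC1.symm
    have h1' := ae_of_ae_map hX.aemeasurable h1
    have h2 := condExp_ae_eq_integral_condDistrib hX hZm.aemeasurable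
      hqstar.stronglyMeasurable hqi
    have h3 := condExp_ae_eq_integral_condDistrib hUm hZm.aemeasurable
      hqstar.stronglyMeasurable hqi
    filter_upwards [h1', h2, h3, hbridge] with ω a1 a2 a3 a4
    rw [a2, a1, ← a4, a3, Kernel.prodMkRight_apply]
  -- key identity
  have key : ∀ B : Set 𝒲, MeasurableSet B →
      ∫⁻ ω in Wm ⁻¹' B, (P.map Up).rnDeriv (P.map Um) (Um ω) ∂P = P.map Wp B := by
    intro B hB
    have hC : MeasurableSet ((Prod.snd : ℝ × 𝒲 → 𝒲) ⁻¹' B) := measurable_snd hB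
    have hr : Measurable ((P.map Up).rnDeriv (P.map Um)) := Measure.measurable_rnDeriv _ _
    have hr1 : Measurable (fun p : 𝒰 × ℝ × 𝒲 => (P.map Up).rnDeriv (P.map Um) p.1) :=
      hr.comp measurable_fst
    have e1 : ∫⁻ ω in Wm ⁻¹' B, (P.map Up).rnDeriv (P.map Um) (Um ω) ∂P
        = ∫⁻ p in (Set.univ : Set 𝒰) ×ˢ ((Prod.snd : ℝ × 𝒲 → 𝒲) ⁻¹' B),
            (P.map Up).rnDeriv (P.map Um) p.1 ∂(P.map (fun ω => (Um ω, (Ym ω, Wm ω)))) := by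
      rw [setLIntegral_map (MeasurableSet.univ.prod hC) hr1 hX]
      congr 2
      ext ω
      simp
    rw [e1, ← compProd_map_condDistrib (μ := P) (X := Um) hVm.aemeasurable,
      Measure.setLIntegral_compProd hr1 MeasurableSet.univ hC]
    simp only [setLIntegral_const, Measure.restrict_univ]
    rw [lintegral_rnDeriv_mul habs (Kernel.measurable_coe _ hC).aemeasurable,
      lintegral_congr_ae (g := fun u => condDistrib (fun ω => (Yp ω, Wp ω)) Up P u
        ((Prod.snd : ℝ × 𝒲 → 𝒲) ⁻¹' B))
        (by filter_upwards [habs.ae_le hC4] with u hu; rw [hu])]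
    have e2 := congrArg (fun μ : Measure (𝒰 × ℝ × 𝒲) => μ (Set.univ ×ˢ ((Prod.snd : ℝ × 𝒲 → 𝒲) ⁻¹' B)))
      (compProd_map_condDistrib (μ := P) (X := Up) hVp.aemeasurable)
    rw [Measure.compProd_apply_prod MeasurableSet.univ hC, Measure.restrict_univ,
      Measure.map_apply (hUp.prodMk hVp) (MeasurableSet.univ.prod hC)] at e2
    rw [e2, Measure.map_apply hWp hB]
    congr 1
    ext ω
    simp
  have hWac : P.map Wp ≪ P.map Wm := by
    refine Measure.AbsolutelyContinuous.mk fun B hB h0 => ?_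
    rw [← key B hB]
    rw [Measure.map_apply hWm hB] at h0
    exact setLIntegral_measure_zero _ _ h0
  have hrW : Measurable ((P.map Wp).rnDeriv (P.map Wm)) := Measure.measurable_rnDeriv _ _
  have hrWi : Integrable (fun ω => ((P.map Wp).rnDeriv (P.map Wm) (Wm ω)).toReal) P :=
    (Measure.integrable_toReal_rnDeriv (μ := P.map Wp) (ν := P.map Wm)).comp_measurable hWm
  symm
  refine ae_eq_condExp_of_forall_setIntegral_eq hWm.comap_le hqi
    (fun _ _ _ => hrWi.integrableOn) ?_ ?_
  · rintro s ⟨B, hB, rfl⟩ -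
    have hs : MeasurableSet[MeasurableSpace.comap (fun ω => (Um ω, (Ym ω, Wm ω))) inferInstance]
        (Wm ⁻¹' B) :=
      ⟨(fun p : 𝒰 × ℝ × 𝒲 => p.2.2) ⁻¹' B, (measurable_snd.comp measurable_snd) hB, rfl⟩
    rw [← setIntegral_condExp hX.comap_le hqi hs,
      setIntegral_congr_ae (hWm hB) (hUV.mono fun ω h _ => h)]
    rw [integral_toReal, integral_toReal, key B hB,
      ← setLIntegral_map hB hrW hWm, Measure.setLIntegral_rnDeriv hWac]
    · exact ((Measure.measurable_rnDeriv _ _).comp hUm).aemeasurable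
    · exact ae_restrict_of_ae (ae_of_ae_map hUm.aemeasurable (Measure.rnDeriv_lt_top _ _))
    · exact (hrW.comp hWm).aemeasurable
    · exact ae_restrict_of_ae (ae_of_ae_map hWm.aemeasurable (Measure.rnDeriv_lt_top _ _))
  · exact ((hrW.ennreal_toReal.comp (comap_measurable Wm)).stronglyMeasurable).aestronglyMeasurable
end

section
/- (Doubly robust identification, treatment-bridge case.) Under Conditions (C1), (C4) and (C6), for every measurable h : 𝒲 → ℝ such that Y₋ − h(W₋) ∈ L²(P) and h∘W₊, Y₊ ∈ L¹(P), one has E[q*(Z₋)·(Y₋ − h(W₋))] = E[Y₊ − h(W₊)], and hence E[q*(Z₋)·(Y₋ − h(W₋)) + h(W₊)] = E[Y₊]. -/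
open MeasureTheory ProbabilityTheory MeasurableSpace

/-- **Doubly robust identification, treatment-bridge case.** Under Conditions (C1), (C4) and
(C6), for every measurable `h : 𝒲 → ℝ` with the stated integrability,
`E[q*(Z₋)·(Y₋ − h(W₋))] = E[Y₊ − h(W₊)]`, and hence
`E[q*(Z₋)·(Y₋ − h(W₋)) + h(W₊)] = E[Y₊]`. -/
theorem doubly_robust_identification_treatment_bridge
    {Ω 𝒰 𝒲 𝒵 : Type*}
    [MeasurableSpace Ω] [StandardBorelSpace Ω] [Nonempty Ω]
    [MeasurableSpace 𝒰] [StandardBorelSpace 𝒰]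
    [MeasurableSpace 𝒲] [StandardBorelSpace 𝒲] [Nonempty 𝒲]
    [MeasurableSpace 𝒵] [StandardBorelSpace 𝒵]
    (P : Measure Ω) [IsProbabilityMeasure P]
    (Um Up : Ω → 𝒰) (Wm Wp : Ω → 𝒲) (Zm : Ω → 𝒵) (Ym Yp : Ω → ℝ)
    (hUm : Measurable Um) (hUp : Measurable Up)
    (hWm : Measurable Wm) (hWp : Measurable Wp)
    (hZm : Measurable Zm) (hYm : Measurable Ym) (hYp : Measurable Yp)
    -- Condition (C1): Z₋ ⫫ (Y₋, W₋) | σ(U₋)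
    (hC1 : CondIndepFun (MeasurableSpace.comap Um inferInstance) hUm.comap_le
      Zm (fun ω => (Ym ω, Wm ω)) P)
    -- Condition (C4): covariate shift
    (hC4 : ∀ᵐ u ∂(P.map Um),
      condDistrib (fun ω => (Ym ω, Wm ω)) Um P u
        = condDistrib (fun ω => (Yp ω, Wp ω)) Up P u)
    -- Condition (C6): treatment confounding bridge
    (qstar : 𝒵 → ℝ) (hqstar : Measurable qstar)
    (habs : P.map Up ≪ P.map Um)
    (hqL2 : MemLp (fun ω => qstar (Zm ω)) 2 P)
    (hbridge : P[(fun ω => qstar (Zm ω)) | MeasurableSpace.comap Um inferInstance]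
      =ᵐ[P] fun ω => ((P.map Up).rnDeriv (P.map Um) (Um ω)).toReal)
    -- arbitrary measurable h with integrability
    (h : 𝒲 → ℝ) (hh : Measurable h)
    (hYhL2 : MemLp (fun ω => Ym ω - h (Wm ω)) 2 P)
    (hhWp : Integrable (fun ω => h (Wp ω)) P)
    (hYpInt : Integrable Yp P) :
    ∫ ω, qstar (Zm ω) * (Ym ω - h (Wm ω)) ∂P = ∫ ω, (Yp ω - h (Wp ω)) ∂P ∧
    ∫ ω, (qstar (Zm ω) * (Ym ω - h (Wm ω)) + h (Wp ω)) ∂P = ∫ ω, Yp ω ∂P := by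
  classical
  have hle := hUm.comap_le
  have hfm : Measurable (fun p : ℝ × 𝒲 => p.1 - h p.2) := by fun_prop
  have hAm : Measurable (fun ω => qstar (Zm ω)) := hqstar.comp hZm
  have hBm : Measurable (fun ω => Ym ω - h (Wm ω)) := hYm.sub (hh.comp hWm)
  have hAB : Integrable (fun ω => qstar (Zm ω) * (Ym ω - h (Wm ω))) P :=
    hqL2.integrable_mul hYhL2
  have hB : Integrable (fun ω => Ym ω - h (Wm ω)) P := hYhL2.integrable (by norm_num)
  have hA : Integrable (fun ω => qstar (Zm ω)) P := hqL2.integrable (by norm_num)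
  have hci : CondIndepFun (MeasurableSpace.comap Um inferInstance) hle (fun ω => qstar (Zm ω)) (fun ω => Ym ω - h (Wm ω)) P :=
    hC1.comp hqstar hfm
  rw [condIndepFun_iff_map_prod_eq_prod_map_map hAm hBm] at hci
  have hci' := ae_of_ae_trim hle hci
  have hprod : P[(fun ω => qstar (Zm ω) * (Ym ω - h (Wm ω))) | (MeasurableSpace.comap Um inferInstance)] =ᵐ[P]
      fun ω => (P[(fun ω => qstar (Zm ω)) | (MeasurableSpace.comap Um inferInstance)]) ω * (P[(fun ω => Ym ω - h (Wm ω)) | (MeasurableSpace.comap Um inferInstance)]) ω := by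
    filter_upwards [hci', condExp_ae_eq_integral_condExpKernel hle hAB,
      condExp_ae_eq_integral_condExpKernel hle hA,
      condExp_ae_eq_integral_condExpKernel hle hB] with ω h1 h2 h3 h4
    rw [h2, h3, h4]
    have hind : IndepFun (fun ω => qstar (Zm ω)) (fun ω => Ym ω - h (Wm ω))
        (condExpKernel P (MeasurableSpace.comap Um inferInstance) ω) := by
      rw [indepFun_iff_map_prod_eq_prod_map_map hAm.aemeasurable hBm.aemeasurable]
      rw [Kernel.map_apply _ (hAm.prodMk hBm), Kernel.prod_apply, Kernel.map_apply _ hAm,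
        Kernel.map_apply _ hBm] at h1
      exact h1
    exact hind.integral_fun_mul_eq_mul_integral hAm.aestronglyMeasurable hBm.aestronglyMeasurable
  have hBc : P[(fun ω => Ym ω - h (Wm ω)) | (MeasurableSpace.comap Um inferInstance)] =ᵐ[P] fun ω =>
      ∫ p, (p.1 - h p.2) ∂(condDistrib (fun ω => (Ym ω, Wm ω)) Um P (Um ω)) :=
    condExp_ae_eq_integral_condDistrib (f := fun p : ℝ × 𝒲 => p.1 - h p.2) hUm
      (hYm.prodMk hWm).aemeasurable hfm.stronglyMeasurable hB
  have hBp : P[(fun ω => Yp ω - h (Wp ω)) | MeasurableSpace.comap Up inferInstance] =ᵐ[P] fun ω =>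
      ∫ p, (p.1 - h p.2) ∂(condDistrib (fun ω => (Yp ω, Wp ω)) Up P (Up ω)) :=
    condExp_ae_eq_integral_condDistrib (f := fun p : ℝ × 𝒲 => p.1 - h p.2) hUp
      (hYp.prodMk hWp).aemeasurable hfm.stronglyMeasurable (hYpInt.sub hhWp)
  have : IsProbabilityMeasure (P.map Um) := Measure.isProbabilityMeasure_map hUm.aemeasurable
  have : IsProbabilityMeasure (P.map Up) := Measure.isProbabilityMeasure_map hUp.aemeasurable
  have hgm : StronglyMeasurable (fun u => 
      ∫ p, (p.1 - h p.2) ∂(condDistrib (fun ω => (Ym ω, Wm ω)) Um P u)) :=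
    StronglyMeasurable.integral_kernel (f := fun p : ℝ × 𝒲 => p.1 - h p.2) hfm.stronglyMeasurable
  have hgp : StronglyMeasurable (fun u => 
      ∫ p, (p.1 - h p.2) ∂(condDistrib (fun ω => (Yp ω, Wp ω)) Up P u)) :=
    StronglyMeasurable.integral_kernel (f := fun p : ℝ × 𝒲 => p.1 - h p.2) hfm.stronglyMeasurable
  have key : ∫ ω, qstar (Zm ω) * (Ym ω - h (Wm ω)) ∂P = ∫ ω, (Yp ω - h (Wp ω)) ∂P := by
    calc ∫ ω, qstar (Zm ω) * (Ym ω - h (Wm ω)) ∂P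
        = ∫ ω, (P[(fun ω => qstar (Zm ω) * (Ym ω - h (Wm ω))) | (MeasurableSpace.comap Um inferInstance)]) ω ∂P :=
          (integral_condExp hle).symm
      _ = ∫ ω, (fun u => ((P.map Up).rnDeriv (P.map Um) u).toReal •
            ∫ p, (p.1 - h p.2) ∂(condDistrib (fun ω => (Ym ω, Wm ω)) Um P u)) (Um ω) ∂P := by
          apply integral_congr_ae
          filter_upwards [hprod, hbridge, hBc] with ω h1 h2 h3
          rw [h1, h2, h3, smul_eq_mul]
      _ = ∫ u, ((P.map Up).rnDeriv (P.map Um) u).toReal •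
            ∫ p, (p.1 - h p.2) ∂(condDistrib (fun ω => (Ym ω, Wm ω)) Um P u) ∂(P.map Um) := by
          rw [integral_map hUm.aemeasurable]
          exact ((Measure.measurable_rnDeriv _ _).ennreal_toReal.stronglyMeasurable.smul
            hgm).aestronglyMeasurable
      _ = ∫ u, ∫ p, (p.1 - h p.2) ∂(condDistrib (fun ω => (Ym ω, Wm ω)) Um P u) ∂(P.map Up) :=
          integral_rnDeriv_smul habs
      _ = ∫ u, ∫ p, (p.1 - h p.2) ∂(condDistrib (fun ω => (Yp ω, Wp ω)) Up P u) ∂(P.map Up) := by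
          apply integral_congr_ae
          filter_upwards [habs.ae_le hC4] with u hu
          rw [hu]
      _ = ∫ ω, ∫ p, (p.1 - h p.2) ∂(condDistrib (fun ω => (Yp ω, Wp ω)) Up P (Up ω)) ∂P :=
          integral_map hUp.aemeasurable hgp.aestronglyMeasurable
      _ = ∫ ω, (P[(fun ω => Yp ω - h (Wp ω)) | MeasurableSpace.comap Up inferInstance]) ω ∂P :=
          (integral_congr_ae hBp).symm
      _ = ∫ ω, (Yp ω - h (Wp ω)) ∂P := integral_condExp hUp.comap_le
  refine ⟨key, ?_⟩
  rw [integral_add hAB hhWp, key, integral_sub hYpInt hhWp, sub_add_cancel]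
end

section
/- Under Conditions (C1), (C4) and (C8) of the finite-horizon weighted setting, for every measurable f : ℝ → ℝ with f∘Y_t ∈ L²(P) for all t ∈ {1,…,T}, one has (1/T₀)·∑_{t=1}^{T₀} E[q̃(Z_t) · f(Y_t)] = ∑_{t=T₀+1}^{T} ℓ(t) · E[f(Y_t)]. In particular, taking f the identity, the ℓ-weighted average of the counterfactual untreated post-treatment means is identified as ∑_{t=T₀+1}^{T} ℓ(t) E[Y_t] = (1/T₀)∑_{t=1}^{T₀} E[q̃(Z_t) Y_t]. -/
open MeasureTheory ProbabilityTheory MeasurableSpace Finset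

/-- **Identification of the weighted ATT via the treatment confounding bridge (finite horizon).**
Under Conditions (C1), (C4) and (C8), for every square-integrable transform `f`,
`(1/T₀) ∑_{t ≤ T₀} E[q̃(Z_t) f(Y_t)] = ∑_{t > T₀} ℓ(t) E[f(Y_t)]`. -/
theorem weighted_identification_via_treatment_bridge
    {Ω 𝒰 𝒲 𝒵 : Type*}
    [MeasurableSpace Ω] [StandardBorelSpace Ω] [Nonempty Ω]
    [MeasurableSpace 𝒰] [StandardBorelSpace 𝒰]
    [MeasurableSpace 𝒲] [StandardBorelSpace 𝒲] [Nonempty 𝒲]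
    [MeasurableSpace 𝒵] [StandardBorelSpace 𝒵]
    (P : Measure Ω) [IsProbabilityMeasure P]
    (T₀ T : ℕ) (hT₀ : 0 < T₀) (hT : T₀ < T)
    (U : ℕ → Ω → 𝒰) (W : ℕ → Ω → 𝒲) (Z : ℕ → Ω → 𝒵) (Y : ℕ → Ω → ℝ)
    (hU : ∀ t, Measurable (U t)) (hW : ∀ t, Measurable (W t))
    (hZ : ∀ t, Measurable (Z t)) (hY : ∀ t, Measurable (Y t))
    -- importance weight over post-treatment periods
    (ℓ : ℕ → ℝ) (hℓ_nonneg : ∀ t ∈ Finset.Icc (T₀ + 1) T, 0 ≤ ℓ t)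
    (hℓ_sum : ∑ t ∈ Finset.Icc (T₀ + 1) T, ℓ t = 1)
    -- Condition (C1): for every pre-treatment period, Z_t ⫫ (Y_t, W_t) | σ(U_t)
    (hC1 : ∀ t ∈ Finset.Icc 1 T₀,
      CondIndepFun (MeasurableSpace.comap (U t) inferInstance) ((hU t).comap_le)
        (Z t) (fun ω => (Y t ω, W t ω)) P)
    -- Condition (C4): covariate shift via a common Markov kernel κ
    (κ : Kernel 𝒰 (ℝ × 𝒲)) [IsMarkovKernel κ]
    (hC4 : ∀ t ∈ Finset.Icc 1 T, ∀ᵐ u ∂(P.map (U t)),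
      condDistrib (fun ω => (Y t ω, W t ω)) (U t) P u = κ u)
    -- Condition (C8): treatment confounding bridge
    (qt : 𝒵 → ℝ) (hqt : Measurable qt)
    (hqtL2 : ∀ t ∈ Finset.Icc 1 T₀, MemLp (fun ω => qt (Z t ω)) 2 P)
    (hC8 : ∀ g : 𝒰 → ℝ, Measurable g →
      (∀ t ∈ Finset.Icc 1 T, MemLp (fun ω => g (U t ω)) 2 P) →
      (1 / (T₀ : ℝ)) * ∑ t ∈ Finset.Icc 1 T₀, ∫ ω, qt (Z t ω) * g (U t ω) ∂P
        = ∑ t ∈ Finset.Icc (T₀ + 1) T, ℓ t * ∫ ω, g (U t ω) ∂P)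
    -- the transform f
    (f : ℝ → ℝ) (hf : Measurable f)
    (hfY : ∀ t ∈ Finset.Icc 1 T, MemLp (fun ω => f (Y t ω)) 2 P) :
    (1 / (T₀ : ℝ)) * ∑ t ∈ Finset.Icc 1 T₀, ∫ ω, qt (Z t ω) * f (Y t ω) ∂P
      = ∑ t ∈ Finset.Icc (T₀ + 1) T, ℓ t * ∫ ω, f (Y t ω) ∂P := by
  have hZne : Nonempty 𝒵 := ⟨Z 0 (Classical.arbitrary Ω)⟩
  have hfst : StronglyMeasurable (fun p : ℝ × 𝒲 => f p.1) :=
    (hf.comp measurable_fst).stronglyMeasurable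
  set g : 𝒰 → ℝ := fun u => ∫ p, f p.1 ∂(κ u) with hg
  have hgm : Measurable g := (hfst.integral_kernel (κ := κ)).measurable
  have hint : ∀ t ∈ Finset.Icc 1 T, Integrable (fun ω => f (Y t ω)) P :=
    fun t ht => (hfY t ht).integrable (by norm_num)
  have hYW : ∀ t, Measurable (fun ω => (Y t ω, W t ω)) := fun t => (hY t).prodMk (hW t)
  have hce : ∀ t ∈ Finset.Icc 1 T,
      P[fun ω => f (Y t ω) | MeasurableSpace.comap (U t) inferInstance]
        =ᵐ[P] fun ω => g (U t ω) := by
    intro t ht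
    have h1 := condExp_ae_eq_integral_condDistrib (μ := P) (hU t) (hYW t).aemeasurable hfst
      (hint t ht)
    have h2 := ae_of_ae_map (hU t).aemeasurable (hC4 t ht)
    filter_upwards [h1, h2] with ω h1 h2
    rw [h1, h2]
  have hgL : ∀ t ∈ Finset.Icc 1 T, MemLp (fun ω => g (U t ω)) 2 P := by
    intro t ht
    exact (MemLp.condExp (by norm_num) (hfY t ht)).ae_eq (hce t ht)
  have hpost : ∀ t ∈ Finset.Icc 1 T, ∫ ω, g (U t ω) ∂P = ∫ ω, f (Y t ω) ∂P := by
    intro t ht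
    rw [← integral_congr_ae (hce t ht), integral_condExp (hU t).comap_le]
  have hpre : ∀ t ∈ Finset.Icc 1 T₀,
      ∫ ω, qt (Z t ω) * g (U t ω) ∂P = ∫ ω, qt (Z t ω) * f (Y t ω) ∂P := by
    intro t ht
    have ht' : t ∈ Finset.Icc 1 T := by
      simp only [Finset.mem_Icc] at ht ⊢
      omega
    have hUZ : Measurable (fun ω => (U t ω, Z t ω)) := (hU t).prodMk (hZ t)
    have h0 := (condIndepFun_iff_condDistrib_prod_ae_eq_prodMkRight (μ := P)
      (hYW t) (hZ t) (hU t)).1 (hC1 t ht)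
    have h0' := ae_of_ae_map hUZ.aemeasurable h0
    have h1 := condExp_ae_eq_integral_condDistrib (μ := P) hUZ (hYW t).aemeasurable hfst
      (hint t ht')
    have h2 := ae_of_ae_map (hU t).aemeasurable (hC4 t ht')
    have h3 : P[fun ω => f (Y t ω) |
        MeasurableSpace.comap (fun ω => (U t ω, Z t ω)) inferInstance]
        =ᵐ[P] fun ω => g (U t ω) := by
      filter_upwards [h0', h1, h2] with ω h0 h1 h2
      rw [h1, h0, Kernel.prodMkRight_apply, h2]
    have hq : StronglyMeasurable[MeasurableSpace.comap (fun ω => (U t ω, Z t ω)) inferInstance]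
        (fun ω => qt (Z t ω)) :=
      ((hqt.comp measurable_snd).comp (comap_measurable (fun ω => (U t ω, Z t ω)))).stronglyMeasurable
    have hmul : Integrable ((fun ω => qt (Z t ω)) * fun ω => f (Y t ω)) P :=
      (hqtL2 t ht).integrable_mul (hfY t ht')
    have h4 := condExp_mul_of_stronglyMeasurable_left hq hmul (hint t ht')
    have h5 := integral_condExp (μ := P) (f := (fun ω => qt (Z t ω)) * fun ω => f (Y t ω))
      hUZ.comap_le
    rw [integral_congr_ae h4] at h5
    simp only [Pi.mul_apply] at h5
    rw [← h5]
    refine integral_congr_ae ?_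
    filter_upwards [h3] with ω h3
    rw [h3]
  have key := hC8 g hgm hgL
  rw [Finset.sum_congr rfl hpre] at key
  rw [key]
  refine Finset.sum_congr rfl fun t ht => ?_
  rw [hpost t (by simp only [Finset.mem_Icc] at ht ⊢; omega)]
end

section
/- Under Conditions (C1), (C4) and (C8) of the finite-horizon weighted setting, the treatment confounding bridge function q̃ solves the weighted moment system in the observed proxies: for every measurable g : 𝒲 → ℝ with g∘W_t ∈ L²(P) for all t ∈ {1,…,T}, (1/T₀)·∑_{t=1}^{T₀} E[q̃(Z_t) · g(W_t)] = ∑_{t=T₀+1}^{T} ℓ(t) · E[g(W_t)]. -/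
open MeasureTheory ProbabilityTheory MeasurableSpace Finset

/-- Under Conditions (C1), (C4) and (C8) of the finite-horizon weighted setting, the treatment
confounding bridge `q̃` solves the weighted moment system in the observed proxies. -/
theorem weighted_treatment_bridge_solves_moment_system
    {Ω 𝒰 𝒲 𝒵 : Type*}
    [MeasurableSpace Ω] [StandardBorelSpace Ω] [Nonempty Ω]
    [MeasurableSpace 𝒰] [StandardBorelSpace 𝒰]
    [MeasurableSpace 𝒲] [StandardBorelSpace 𝒲] [Nonempty 𝒲]
    [MeasurableSpace 𝒵] [StandardBorelSpace 𝒵]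
    (P : Measure Ω) [IsProbabilityMeasure P]
    (T₀ T : ℕ) (hT₀ : 0 < T₀) (hT : T₀ < T)
    (U : ℕ → Ω → 𝒰) (W : ℕ → Ω → 𝒲) (Z : ℕ → Ω → 𝒵) (Y : ℕ → Ω → ℝ)
    (hU : ∀ t, Measurable (U t)) (hW : ∀ t, Measurable (W t))
    (hZ : ∀ t, Measurable (Z t)) (hY : ∀ t, Measurable (Y t))
    -- importance weight over post-treatment periods
    (ℓ : ℕ → ℝ) (hℓ_nonneg : ∀ t ∈ Finset.Icc (T₀ + 1) T, 0 ≤ ℓ t)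
    (hℓ_sum : ∑ t ∈ Finset.Icc (T₀ + 1) T, ℓ t = 1)
    -- Condition (C1): for every pre-treatment period, Z_t ⫫ (Y_t, W_t) | σ(U_t)
    (hC1 : ∀ t ∈ Finset.Icc 1 T₀,
      CondIndepFun (MeasurableSpace.comap (U t) inferInstance) ((hU t).comap_le)
        (Z t) (fun ω => (Y t ω, W t ω)) P)
    -- Condition (C4): covariate shift via a common Markov kernel κ
    (κ : Kernel 𝒰 (ℝ × 𝒲)) [IsMarkovKernel κ]
    (hC4 : ∀ t ∈ Finset.Icc 1 T, ∀ᵐ u ∂(P.map (U t)),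
      condDistrib (fun ω => (Y t ω, W t ω)) (U t) P u = κ u)
    -- Condition (C8): treatment confounding bridge
    (qt : 𝒵 → ℝ) (hqt : Measurable qt)
    (hqtL2 : ∀ t ∈ Finset.Icc 1 T₀, MemLp (fun ω => qt (Z t ω)) 2 P)
    (hC8 : ∀ g : 𝒰 → ℝ, Measurable g →
      (∀ t ∈ Finset.Icc 1 T, MemLp (fun ω => g (U t ω)) 2 P) →
      (1 / (T₀ : ℝ)) * ∑ t ∈ Finset.Icc 1 T₀, ∫ ω, qt (Z t ω) * g (U t ω) ∂P
        = ∑ t ∈ Finset.Icc (T₀ + 1) T, ℓ t * ∫ ω, g (U t ω) ∂P)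
    -- the transform g of the outcome proxies
    (g : 𝒲 → ℝ) (hg : Measurable g)
    (hgW : ∀ t ∈ Finset.Icc 1 T, MemLp (fun ω => g (W t ω)) 2 P) :
    (1 / (T₀ : ℝ)) * ∑ t ∈ Finset.Icc 1 T₀, ∫ ω, qt (Z t ω) * g (W t ω) ∂P
      = ∑ t ∈ Finset.Icc (T₀ + 1) T, ℓ t * ∫ ω, g (W t ω) ∂P := by
  have hYW : ∀ t, Measurable (fun ω => (Y t ω, W t ω)) := fun t => (hY t).prodMk (hW t)
  have hg2 : StronglyMeasurable (fun y : ℝ × 𝒲 => g y.2) :=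
    (hg.comp measurable_snd).stronglyMeasurable
  have hh : Measurable (fun u => ∫ y, g y.2 ∂(κ u)) :=
    hg2.integral_kernel.measurable
  have hint : ∀ t ∈ Finset.Icc 1 T, Integrable (fun ω => g (W t ω)) P := fun t ht =>
    (hgW t ht).integrable one_le_two
  have hce : ∀ t ∈ Finset.Icc 1 T,
      P[fun ω => g (W t ω) | MeasurableSpace.comap (U t) inferInstance]
        =ᵐ[P] fun ω => ∫ y, g y.2 ∂(κ (U t ω)) := by
    intro t ht
    have h1 := condExp_ae_eq_integral_condDistrib (μ := P) (hU t) (hYW t).aemeasurable hg2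
      (hint t ht)
    have h2 := ae_of_ae_map (hU t).aemeasurable (hC4 t ht)
    filter_upwards [h1, h2] with ω a b
    rw [← b]
    exact a
  have hL2 : ∀ t ∈ Finset.Icc 1 T, MemLp (fun ω => ∫ y, g y.2 ∂(κ (U t ω))) 2 P := fun t ht =>
    ((hgW t ht).condExp (m := MeasurableSpace.comap (U t) inferInstance) one_le_two).ae_eq
      (hce t ht)
  have key := hC8 _ hh hL2
  have hpost : ∀ t ∈ Finset.Icc 1 T,
      ∫ ω, (∫ y, g y.2 ∂(κ (U t ω))) ∂P = ∫ ω, g (W t ω) ∂P := by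
    intro t ht
    rw [← integral_condExp (hU t).comap_le (f := fun ω => g (W t ω))]
    exact (integral_congr_ae (hce t ht)).symm
  have hpre : ∀ t ∈ Finset.Icc 1 T₀,
      ∫ ω, qt (Z t ω) * (∫ y, g y.2 ∂(κ (U t ω))) ∂P = ∫ ω, qt (Z t ω) * g (W t ω) ∂P := by
    intro t ht
    have ht' : t ∈ Finset.Icc 1 T := by
      simp only [Finset.mem_Icc] at ht ⊢
      omega
    haveI : Nonempty 𝒵 := Nonempty.map (Z t) inferInstance
    have hUZ : Measurable (fun ω => (U t ω, Z t ω)) := (hU t).prodMk (hZ t)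
    have hci := (condIndepFun_iff_condDistrib_prod_ae_eq_prodMkRight (μ := P) (hYW t) (hZ t)
      (hU t)).1 (hC1 t ht)
    have hci' := ae_of_ae_map hUZ.aemeasurable hci
    have h2 := ae_of_ae_map (hU t).aemeasurable (hC4 t ht')
    have hf : StronglyMeasurable (fun p : (𝒰 × 𝒵) × (ℝ × 𝒲) => qt p.1.2 * g p.2.2) := by
      apply Measurable.stronglyMeasurable
      fun_prop
    have h1 := condExp_prod_ae_eq_integral_condDistrib (μ := P) hUZ (hYW t).aemeasurable hf
      ((hqtL2 t ht).integrable_mul (hgW t ht'))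
    rw [← integral_condExp hUZ.comap_le (f := fun ω => qt (Z t ω) * g (W t ω))]
    refine (integral_congr_ae ?_).symm
    filter_upwards [h1, hci', h2] with ω a b c
    refine a.trans ?_
    rw [b, Kernel.prodMkRight_apply, c]
    exact integral_const_mul _ _
  rw [Finset.sum_congr rfl hpre] at key
  rw [key]
  refine Finset.sum_congr rfl fun t ht => ?_
  rw [hpost t (by simp only [Finset.mem_Icc] at ht ⊢; omega)]
end

section
/- (Weighted doubly robust identification, outcome-bridge case.) In the finite-horizon weighted setting, assume Condition (C1) and that h : 𝒲 → ℝ is measurable with E[h(W_t) | σ(U_t)] = E[Y_t | σ(U_t)] P-a.s. for every t ∈ {1,…,T}. Then for every measurable q̃ : 𝒵 → ℝ with q̃∘Z_t ∈ L²(P) for t ≤ T₀, provided Y_t − h(W_t) ∈ L²(P) and h∘W_t, Y_t ∈ L¹(P) for all t, one has (1/T₀)∑_{t=1}^{T₀} E[q̃(Z_t)·(Y_t − h(W_t))] + ∑_{t=T₀+1}^{T} ℓ(t) E[h(W_t)] = ∑_{t=T₀+1}^{T} ℓ(t) E[Y_t]. -/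
open MeasureTheory ProbabilityTheory MeasurableSpace Finset

theorem dr_aux {Ω : Type*} {m mΩ : MeasurableSpace Ω} [StandardBorelSpace Ω]
    (P : Measure Ω) [IsProbabilityMeasure P] (hm : m ≤ mΩ) (X V : Ω → ℝ)
    (hX : Measurable X) (hV : Measurable V) (hi : CondIndepFun m hm X V P)
    (hX2 : MemLp X 2 P) (hV2 : MemLp V 2 P) (h0 : P[V | m] =ᵐ[P] 0) :
    ∫ ω, X ω * V ω ∂P = 0 := by
  have hXV : Integrable (fun ω => X ω * V ω) P := hX2.integrable_mul hV2
  have hV1 : Integrable V P := hV2.integrable (by norm_num)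
  have h1 := ae_of_ae_trim hm ((condIndepFun_iff_map_prod_eq_prod_map_map hX hV).1 hi)
  have h2 := condExp_ae_eq_integral_condExpKernel hm hXV
  have h3 := condExp_ae_eq_integral_condExpKernel hm hV1
  rw [← integral_condExp hm]
  have : P[(fun ω => X ω * V ω) | m] =ᵐ[P] 0 := by
    filter_upwards [h0, h1, h2, h3] with ω h0 h1 h2 h3
    rw [h2]
    rw [Kernel.map_apply _ (hX.prodMk hV), Kernel.prod_apply, Kernel.map_apply _ hX,
      Kernel.map_apply _ hV] at h1
    have hind : IndepFun X V (condExpKernel P m ω) :=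
      (indepFun_iff_map_prod_eq_prod_map_map hX.aemeasurable hV.aemeasurable).2 h1
    rw [hind.integral_fun_mul_eq_mul_integral hX.aestronglyMeasurable hV.aestronglyMeasurable,
      ← h3, h0]
    simp
  rw [integral_congr_ae this]
  simp

/-- **Weighted doubly robust identification, outcome-bridge case.** Under Condition (C1), if
`h` is an outcome confounding bridge at every period, then for every square-integrable `q̃`,
`(1/T₀)∑_{t ≤ T₀} E[q̃(Z_t)(Y_t − h(W_t))] + ∑_{t > T₀} ℓ(t) E[h(W_t)] = ∑_{t > T₀} ℓ(t) E[Y_t]`. -/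
theorem weighted_doubly_robust_outcome_bridge
    {Ω 𝒰 𝒲 𝒵 : Type*}
    [MeasurableSpace Ω] [StandardBorelSpace Ω] [Nonempty Ω]
    [MeasurableSpace 𝒰] [StandardBorelSpace 𝒰]
    [MeasurableSpace 𝒲] [StandardBorelSpace 𝒲]
    [MeasurableSpace 𝒵] [StandardBorelSpace 𝒵]
    (P : Measure Ω) [IsProbabilityMeasure P]
    (T₀ T : ℕ) (hT₀ : 0 < T₀) (hT : T₀ < T)
    (U : ℕ → Ω → 𝒰) (W : ℕ → Ω → 𝒲) (Z : ℕ → Ω → 𝒵) (Y : ℕ → Ω → ℝ)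
    (hU : ∀ t, Measurable (U t)) (hW : ∀ t, Measurable (W t))
    (hZ : ∀ t, Measurable (Z t)) (hY : ∀ t, Measurable (Y t))
    (ℓ : ℕ → ℝ) (hℓ_nonneg : ∀ t ∈ Finset.Icc (T₀ + 1) T, 0 ≤ ℓ t)
    (hℓ_sum : ∑ t ∈ Finset.Icc (T₀ + 1) T, ℓ t = 1)
    -- Condition (C1): for every pre-treatment period, Z_t ⫫ (Y_t, W_t) | σ(U_t)
    (hC1 : ∀ t ∈ Finset.Icc 1 T₀,
      CondIndepFun (MeasurableSpace.comap (U t) inferInstance) ((hU t).comap_le)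
        (Z t) (fun ω => (Y t ω, W t ω)) P)
    -- h is an outcome confounding bridge at every period
    (h : 𝒲 → ℝ) (hh : Measurable h)
    (hbridge : ∀ t ∈ Finset.Icc 1 T,
      P[(fun ω => h (W t ω)) | MeasurableSpace.comap (U t) inferInstance]
        =ᵐ[P] P[Y t | MeasurableSpace.comap (U t) inferInstance])
    -- arbitrary square-integrable weighting function q̃
    (qt : 𝒵 → ℝ) (hqt : Measurable qt)
    (hqtL2 : ∀ t ∈ Finset.Icc 1 T₀, MemLp (fun ω => qt (Z t ω)) 2 P)
    -- integrability
    (hYhL2 : ∀ t ∈ Finset.Icc 1 T, MemLp (fun ω => Y t ω - h (W t ω)) 2 P)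
    (hhW : ∀ t ∈ Finset.Icc 1 T, Integrable (fun ω => h (W t ω)) P)
    (hYInt : ∀ t ∈ Finset.Icc 1 T, Integrable (Y t) P) :
    (1 / (T₀ : ℝ)) * ∑ t ∈ Finset.Icc 1 T₀, ∫ ω, qt (Z t ω) * (Y t ω - h (W t ω)) ∂P
        + ∑ t ∈ Finset.Icc (T₀ + 1) T, ℓ t * ∫ ω, h (W t ω) ∂P
      = ∑ t ∈ Finset.Icc (T₀ + 1) T, ℓ t * ∫ ω, Y t ω ∂P := by
  have hpre : ∀ t ∈ Finset.Icc 1 T₀, ∫ ω, qt (Z t ω) * (Y t ω - h (W t ω)) ∂P = 0 := by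
    intro t ht
    have ht' : t ∈ Finset.Icc 1 T := by
      simp only [Finset.mem_Icc] at ht ⊢
      omega
    have hind := (hC1 t ht).comp (φ := qt) (ψ := fun p : ℝ × 𝒲 => p.1 - h p.2) hqt
      (measurable_fst.sub (hh.comp measurable_snd))
    refine dr_aux P (hU t).comap_le (fun ω => qt (Z t ω)) (fun ω => Y t ω - h (W t ω))
      (hqt.comp (hZ t)) ((hY t).sub (hh.comp (hW t))) hind (hqtL2 t ht) (hYhL2 t ht') ?_
    refine (condExp_sub (hYInt t ht') (hhW t ht') _).trans ?_
    filter_upwards [hbridge t ht'] with ω hω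
    simp [hω]
  rw [Finset.sum_eq_zero hpre, mul_zero, zero_add]
  refine Finset.sum_congr rfl fun t ht => ?_
  have ht' : t ∈ Finset.Icc 1 T := by
    simp only [Finset.mem_Icc] at ht ⊢
    omega
  rw [← integral_condExp (hU t).comap_le, integral_congr_ae (hbridge t ht'),
    integral_condExp (hU t).comap_le]
end

section
/- (Weighted doubly robust identification, treatment-bridge case.) Under Conditions (C1), (C4) and (C8) of the finite-horizon weighted setting, for every measurable h : 𝒲 → ℝ such that Y_t − h(W_t) ∈ L²(P) and h∘W_t, Y_t ∈ L¹(P) for all t ∈ {1,…,T}, one has (1/T₀)∑_{t=1}^{T₀} E[q̃(Z_t)·(Y_t − h(W_t))] + ∑_{t=T₀+1}^{T} ℓ(t) E[h(W_t)] = ∑_{t=T₀+1}^{T} ℓ(t) E[Y_t]. -/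
open MeasureTheory ProbabilityTheory MeasurableSpace Finset

/-- **Weighted doubly robust identification, treatment-bridge case.** Under Conditions (C1),
(C4) and (C8) of the finite-horizon weighted setting, for every measurable `h` with the stated
integrability,
`(1/T₀)∑_{t ≤ T₀} E[q̃(Z_t)(Y_t − h(W_t))] + ∑_{t > T₀} ℓ(t) E[h(W_t)] = ∑_{t > T₀} ℓ(t) E[Y_t]`. -/
theorem weighted_doubly_robust_treatment_bridge
    {Ω 𝒰 𝒲 𝒵 : Type*}
    [MeasurableSpace Ω] [StandardBorelSpace Ω] [Nonempty Ω]
    [MeasurableSpace 𝒰] [StandardBorelSpace 𝒰]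
    [MeasurableSpace 𝒲] [StandardBorelSpace 𝒲] [Nonempty 𝒲]
    [MeasurableSpace 𝒵] [StandardBorelSpace 𝒵]
    (P : Measure Ω) [IsProbabilityMeasure P]
    (T₀ T : ℕ) (hT₀ : 0 < T₀) (hT : T₀ < T)
    (U : ℕ → Ω → 𝒰) (W : ℕ → Ω → 𝒲) (Z : ℕ → Ω → 𝒵) (Y : ℕ → Ω → ℝ)
    (hU : ∀ t, Measurable (U t)) (hW : ∀ t, Measurable (W t))
    (hZ : ∀ t, Measurable (Z t)) (hY : ∀ t, Measurable (Y t))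
    -- importance weight over post-treatment periods
    (ℓ : ℕ → ℝ) (hℓ_nonneg : ∀ t ∈ Finset.Icc (T₀ + 1) T, 0 ≤ ℓ t)
    (hℓ_sum : ∑ t ∈ Finset.Icc (T₀ + 1) T, ℓ t = 1)
    -- Condition (C1): for every pre-treatment period, Z_t ⫫ (Y_t, W_t) | σ(U_t)
    (hC1 : ∀ t ∈ Finset.Icc 1 T₀,
      CondIndepFun (MeasurableSpace.comap (U t) inferInstance) ((hU t).comap_le)
        (Z t) (fun ω => (Y t ω, W t ω)) P)
    -- Condition (C4): covariate shift via a common Markov kernel κ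
    (κ : Kernel 𝒰 (ℝ × 𝒲)) [IsMarkovKernel κ]
    (hC4 : ∀ t ∈ Finset.Icc 1 T, ∀ᵐ u ∂(P.map (U t)),
      condDistrib (fun ω => (Y t ω, W t ω)) (U t) P u = κ u)
    -- Condition (C8): treatment confounding bridge
    (qt : 𝒵 → ℝ) (hqt : Measurable qt)
    (hqtL2 : ∀ t ∈ Finset.Icc 1 T₀, MemLp (fun ω => qt (Z t ω)) 2 P)
    (hC8 : ∀ g : 𝒰 → ℝ, Measurable g →
      (∀ t ∈ Finset.Icc 1 T, MemLp (fun ω => g (U t ω)) 2 P) →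
      (1 / (T₀ : ℝ)) * ∑ t ∈ Finset.Icc 1 T₀, ∫ ω, qt (Z t ω) * g (U t ω) ∂P
        = ∑ t ∈ Finset.Icc (T₀ + 1) T, ℓ t * ∫ ω, g (U t ω) ∂P)
    -- arbitrary measurable h with integrability
    (h : 𝒲 → ℝ) (hh : Measurable h)
    (hYhL2 : ∀ t ∈ Finset.Icc 1 T, MemLp (fun ω => Y t ω - h (W t ω)) 2 P)
    (hhW : ∀ t ∈ Finset.Icc 1 T, Integrable (fun ω => h (W t ω)) P)
    (hYInt : ∀ t ∈ Finset.Icc 1 T, Integrable (Y t) P) :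
    (1 / (T₀ : ℝ)) * ∑ t ∈ Finset.Icc 1 T₀, ∫ ω, qt (Z t ω) * (Y t ω - h (W t ω)) ∂P
        + ∑ t ∈ Finset.Icc (T₀ + 1) T, ℓ t * ∫ ω, h (W t ω) ∂P
      = ∑ t ∈ Finset.Icc (T₀ + 1) T, ℓ t * ∫ ω, Y t ω ∂P := by
  classical
  haveI : Nonempty 𝒵 := ⟨Z 0 (Classical.arbitrary Ω)⟩
  set r : ℝ × 𝒲 → ℝ := fun p => p.1 - h p.2 with hr
  have hrm : Measurable r := by fun_prop
  set g : 𝒰 → ℝ := fun u => ∫ p, r p ∂(κ u) with hg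
  have hgm : Measurable g := (hrm.stronglyMeasurable.integral_kernel).measurable
  have hX : ∀ t, Measurable (fun ω => (Y t ω, W t ω)) := fun t => (hY t).prodMk (hW t)
  have hInt : ∀ t ∈ Finset.Icc 1 T, Integrable (fun ω => r (Y t ω, W t ω)) P :=
    fun t ht => (hYInt t ht).sub (hhW t ht)
  have hce : ∀ t ∈ Finset.Icc 1 T,
      P[fun ω => r (Y t ω, W t ω) | MeasurableSpace.comap (U t) inferInstance]
        =ᵐ[P] fun ω => g (U t ω) := by
    intro t ht
    have h1 := condExp_ae_eq_integral_condDistrib (μ := P) (hU t) (hX t).aemeasurable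
      hrm.stronglyMeasurable (hInt t ht)
    refine h1.trans ?_
    filter_upwards [ae_of_ae_map (hU t).aemeasurable (hC4 t ht)] with ω hω
    rw [hω]
  have hgL2 : ∀ t ∈ Finset.Icc 1 T, MemLp (fun ω => g (U t ω)) 2 P := by
    intro t ht
    exact ((hYhL2 t ht).condExp one_le_two).ae_eq (hce t ht)
  have hpost : ∀ t ∈ Finset.Icc (T₀ + 1) T,
      ∫ ω, g (U t ω) ∂P = ∫ ω, Y t ω ∂P - ∫ ω, h (W t ω) ∂P := by
    intro t ht
    have ht' : t ∈ Finset.Icc 1 T := by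
      rw [Finset.mem_Icc] at ht ⊢; omega
    rw [← integral_sub (hYInt t ht') (hhW t ht'), ← integral_congr_ae (hce t ht'),
      integral_condExp (hU t).comap_le]
  have hpre : ∀ t ∈ Finset.Icc 1 T₀,
      ∫ ω, qt (Z t ω) * (Y t ω - h (W t ω)) ∂P = ∫ ω, qt (Z t ω) * g (U t ω) ∂P := by
    intro t ht
    have ht' : t ∈ Finset.Icc 1 T := by
      rw [Finset.mem_Icc] at ht ⊢; omega
    have hUZ : Measurable (fun ω => (U t ω, Z t ω)) := (hU t).prodMk (hZ t)
    have h0 := (condIndepFun_iff_condDistrib_prod_ae_eq_prodMkRight (hX t) (hZ t) (hU t)).1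
      (hC1 t ht)
    have h1 := condExp_ae_eq_integral_condDistrib (μ := P) hUZ (hX t).aemeasurable
      hrm.stronglyMeasurable (hInt t ht')
    have h2 : P[fun ω => r (Y t ω, W t ω) |
        MeasurableSpace.comap (fun ω => (U t ω, Z t ω)) inferInstance]
        =ᵐ[P] fun ω => g (U t ω) := by
      refine h1.trans ?_
      filter_upwards [ae_of_ae_map (hU t).aemeasurable (hC4 t ht'),
        ae_of_ae_map hUZ.aemeasurable h0] with ω hω hω'
      rw [hω', Kernel.prodMkRight_apply, hω]
    have hqm : StronglyMeasurable[MeasurableSpace.comap (fun ω => (U t ω, Z t ω)) inferInstance]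
        (fun ω => qt (Z t ω)) := by
      have : Measurable[MeasurableSpace.comap (fun ω => (U t ω, Z t ω)) inferInstance]
          ((fun p : 𝒰 × 𝒵 => qt p.2) ∘ (fun ω => (U t ω, Z t ω))) :=
        (hqt.comp measurable_snd).comp (comap_measurable _)
      exact this.stronglyMeasurable
    have hmul : Integrable ((fun ω => qt (Z t ω)) * fun ω => r (Y t ω, W t ω)) P :=
      (hqtL2 t ht).integrable_mul (hYhL2 t ht')
    have h3 := condExp_mul_of_stronglyMeasurable_left hqm hmul (hInt t ht')
    have h4 := integral_condExp (μ := P) hUZ.comap_le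
      (f := (fun ω => qt (Z t ω)) * fun ω => r (Y t ω, W t ω))
    refine h4.symm.trans (integral_congr_ae ?_)
    filter_upwards [h3, h2] with ω a b
    rw [a, Pi.mul_apply, b]
  rw [Finset.sum_congr rfl hpre, hC8 g hgm hgL2, ← Finset.sum_add_distrib]
  refine Finset.sum_congr rfl fun t ht => ?_
  rw [hpost t ht]
  ring
end

section
/- Under Conditions (C1), (C4) and (C10) of the asymptotic weighted setting, for every measurable f : ℝ → ℝ with f∘Y_t ∈ L²(P) for all t, the two sequences T ↦ (1/T₀(T))∑_{t=1}^{T₀(T)} E[q̃(Z_t) · f(Y_t)] and T ↦ ∑_{t=T₀(T)+1}^{T} ℓ_T(t) · E[f(Y_t)] both converge as T → ∞ and have equal limits. -/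
open MeasureTheory ProbabilityTheory MeasurableSpace Finset Filter

/-- **Asymptotic identification of the weighted ATT via the treatment confounding bridge.**
Under Conditions (C1), (C4) and (C10), for every square-integrable transform `f`, the
pre-treatment weighted averages and the post-treatment importance-weighted averages both
converge and have equal limits. -/
theorem asymptotic_identification_via_treatment_bridge
    {Ω 𝒰 𝒲 𝒵 : Type*}
    [MeasurableSpace Ω] [StandardBorelSpace Ω] [Nonempty Ω]
    [MeasurableSpace 𝒰] [StandardBorelSpace 𝒰]
    [MeasurableSpace 𝒲] [StandardBorelSpace 𝒲] [Nonempty 𝒲]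
    [MeasurableSpace 𝒵] [StandardBorelSpace 𝒵]
    (P : Measure Ω) [IsProbabilityMeasure P]
    (U : ℕ → Ω → 𝒰) (W : ℕ → Ω → 𝒲) (Z : ℕ → Ω → 𝒵) (Y : ℕ → Ω → ℝ)
    (hU : ∀ t, Measurable (U t)) (hW : ∀ t, Measurable (W t))
    (hZ : ∀ t, Measurable (Z t)) (hY : ∀ t, Measurable (Y t))
    -- the pre-treatment horizon T₀(T) and its asymptotic fraction γ
    (T₀ : ℕ → ℕ) (hT₀ : ∀ T, 2 ≤ T → 1 ≤ T₀ T ∧ T₀ T < T)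
    (γ : ℝ) (hγ : 0 < γ ∧ γ < 1)
    (hT₀γ : Tendsto (fun T : ℕ => (T₀ T : ℝ) / T) atTop (nhds γ))
    -- importance weights ℓ_T over post-treatment periods
    (ℓ : ℕ → ℕ → ℝ)
    (hℓ_nonneg : ∀ T, 2 ≤ T → ∀ t ∈ Finset.Icc (T₀ T + 1) T, 0 ≤ ℓ T t)
    (hℓ_sum : ∀ T, 2 ≤ T → ∑ t ∈ Finset.Icc (T₀ T + 1) T, ℓ T t = 1)
    -- Condition (C1): for every period, Z_t ⫫ (Y_t, W_t) | σ(U_t)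
    (hC1 : ∀ t, CondIndepFun (MeasurableSpace.comap (U t) inferInstance) ((hU t).comap_le)
        (Z t) (fun ω => (Y t ω, W t ω)) P)
    -- Condition (C4): covariate shift via a common Markov kernel κ
    (κ : Kernel 𝒰 (ℝ × 𝒲)) [IsMarkovKernel κ]
    (hC4 : ∀ t, ∀ᵐ u ∂(P.map (U t)),
      condDistrib (fun ω => (Y t ω, W t ω)) (U t) P u = κ u)
    -- Condition (C10): asymptotic treatment confounding bridge
    (qt : 𝒵 → ℝ) (hqt : Measurable qt)
    (hqtL2 : ∀ t, MemLp (fun ω => qt (Z t ω)) 2 P)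
    (hC10 : ∀ g : 𝒰 → ℝ, Measurable g → (∀ t, MemLp (fun ω => g (U t ω)) 2 P) →
      ∃ L : ℝ,
        Tendsto (fun T => (1 / (T₀ T : ℝ)) *
            ∑ t ∈ Finset.Icc 1 (T₀ T), ∫ ω, qt (Z t ω) * g (U t ω) ∂P) atTop (nhds L) ∧
        Tendsto (fun T => ∑ t ∈ Finset.Icc (T₀ T + 1) T, ℓ T t * ∫ ω, g (U t ω) ∂P)
          atTop (nhds L))
    -- the transform f
    (f : ℝ → ℝ) (hf : Measurable f)
    (hfY : ∀ t, MemLp (fun ω => f (Y t ω)) 2 P) :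
    ∃ L : ℝ,
      Tendsto (fun T => (1 / (T₀ T : ℝ)) *
          ∑ t ∈ Finset.Icc 1 (T₀ T), ∫ ω, qt (Z t ω) * f (Y t ω) ∂P) atTop (nhds L) ∧
      Tendsto (fun T => ∑ t ∈ Finset.Icc (T₀ T + 1) T, ℓ T t * ∫ ω, f (Y t ω) ∂P)
        atTop (nhds L) := by
  set g : 𝒰 → ℝ := fun u => ∫ p, f p.1 ∂(κ u) with hg_def
  have hF : StronglyMeasurable (fun p : ℝ × 𝒲 => f p.1) :=
    (hf.comp measurable_fst).stronglyMeasurable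
  have hg : Measurable g := hF.integral_kernel.measurable
  have hYW : ∀ t, Measurable (fun ω => (Y t ω, W t ω)) := fun t => (hY t).prodMk (hW t)
  have hint : ∀ t, Integrable (fun ω => f (Y t ω)) P := fun t => (hfY t).integrable one_le_two
  have hgU : ∀ t, P[fun ω => f (Y t ω) | MeasurableSpace.comap (U t) inferInstance]
      =ᵐ[P] fun ω => g (U t ω) := by
    intro t
    have h1 := condExp_ae_eq_integral_condDistrib (hU t) (hYW t).aemeasurable hF (hint t)
    have h2 := ae_of_ae_map (hU t).aemeasurable (hC4 t)
    filter_upwards [h1, h2] with ω h1 h2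
    rw [h1, h2]
  have hgUZ : ∀ t, P[fun ω => f (Y t ω) |
      MeasurableSpace.comap (fun ω => (U t ω, Z t ω)) inferInstance]
      =ᵐ[P] fun ω => g (U t ω) := by
    intro t
    have : Nonempty 𝒵 := ⟨Z t (Classical.arbitrary Ω)⟩
    have h1 := condExp_ae_eq_integral_condDistrib ((hU t).prodMk (hZ t))
      (hYW t).aemeasurable hF (hint t)
    have h2 := ae_of_ae_map (hU t).aemeasurable (hC4 t)
    have h3 := ae_of_ae_map ((hU t).prodMk (hZ t)).aemeasurable
      ((condIndepFun_iff_condDistrib_prod_ae_eq_prodMkRight (hYW t) (hZ t) (hU t)).1 (hC1 t))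
    filter_upwards [h1, h2, h3] with ω h1 h2 h3
    rw [h1, h3, Kernel.prodMkRight_apply, h2]
  obtain ⟨L, hL1, hL2⟩ := hC10 g hg
    (fun t => ((hfY t).condExp one_le_two).ae_eq (hgU t))
  refine ⟨L, ?_, ?_⟩
  · have key : ∀ t, ∫ ω, qt (Z t ω) * f (Y t ω) ∂P = ∫ ω, qt (Z t ω) * g (U t ω) ∂P := by
      intro t
      have hle := ((hU t).prodMk (hZ t)).comap_le
      have hq : StronglyMeasurable[MeasurableSpace.comap (fun ω => (U t ω, Z t ω)) inferInstance]
          (fun ω => qt (Z t ω)) :=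
        ((hqt.comp measurable_snd).comp
          (comap_measurable (fun ω => (U t ω, Z t ω)))).stronglyMeasurable
      have h := condExp_mul_of_stronglyMeasurable_left hq
        ((hqtL2 t).integrable_mul (hfY t)) (hint t)
      calc ∫ ω, qt (Z t ω) * f (Y t ω) ∂P
          = ∫ ω, (P[(fun ω => qt (Z t ω)) * (fun ω => f (Y t ω)) |
            MeasurableSpace.comap (fun ω => (U t ω, Z t ω)) inferInstance]) ω ∂P :=
            (integral_condExp hle).symm
        _ = ∫ ω, qt (Z t ω) * g (U t ω) ∂P := by
            apply integral_congr_ae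
            filter_upwards [h, hgUZ t] with ω h h'
            rw [h, Pi.mul_apply, h']
    simpa only [key] using hL1
  · have key : ∀ t, ∫ ω, f (Y t ω) ∂P = ∫ ω, g (U t ω) ∂P := by
      intro t
      rw [← integral_condExp (hU t).comap_le]
      exact integral_congr_ae (hgU t)
    simpa only [key] using hL2
end

section
/- (Asymptotic doubly robust identification.) In the asymptotic weighted setting, assume Condition (C1) and Condition (C4), let h : 𝒲 → ℝ and q̃ : 𝒵 → ℝ be measurable with q̃∘Z_t ∈ L²(P), Y_t − h(W_t) ∈ L²(P), and h∘W_t, Y_t ∈ L¹(P) for all t, and suppose that either (i) E[h(W_t) | σ(U_t)] = E[Y_t | σ(U_t)] P-a.s. for all t, or (ii) q̃ satisfies Condition (C10). Then the difference D_T := ∑_{t=T₀(T)+1}^{T} ℓ_T(t) E[Y_t] − { (1/T₀(T))∑_{t=1}^{T₀(T)} E[q̃(Z_t)·(Y_t − h(W_t))] + ∑_{t=T₀(T)+1}^{T} ℓ_T(t) E[h(W_t)] } converges to 0 as T → ∞. -/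
open MeasureTheory ProbabilityTheory MeasurableSpace Finset Filter

lemma bridge_aux {Ω 𝒰 𝒲 𝒵 : Type*}
    [MeasurableSpace Ω] [StandardBorelSpace Ω] [Nonempty Ω]
    [MeasurableSpace 𝒰]
    [MeasurableSpace 𝒲] [StandardBorelSpace 𝒲] [Nonempty 𝒲]
    [MeasurableSpace 𝒵] [StandardBorelSpace 𝒵]
    (P : Measure Ω) [IsProbabilityMeasure P]
    (U : Ω → 𝒰) (V : Ω → 𝒲) (Z : Ω → 𝒵)
    (hU : Measurable U) (hV : Measurable V) (hZ : Measurable Z)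
    (hC1 : CondIndepFun (MeasurableSpace.comap U inferInstance) hU.comap_le Z V P)
    (f : 𝒲 → ℝ) (hf : Measurable f) (q : 𝒵 → ℝ) (hq : Measurable q)
    (hqL : MemLp (fun ω => q (Z ω)) 2 P) (hfL : MemLp (fun ω => f (V ω)) 2 P)
    (g : 𝒰 → ℝ)
    (hg : P[(fun ω => f (V ω)) | MeasurableSpace.comap U inferInstance] =ᵐ[P]
      fun ω => g (U ω)) :
    ∫ ω, q (Z ω) * f (V ω) ∂P = ∫ ω, q (Z ω) * g (U ω) ∂P := by
  have : Nonempty 𝒵 := Nonempty.map Z inferInstance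
  have hfI : Integrable (fun ω => f (V ω)) P := hfL.integrable (by norm_num)
  have hUZ : Measurable (fun ω => (U ω, Z ω)) := hU.prodMk hZ
  have h1 := (condIndepFun_iff_condDistrib_prod_ae_eq_prodMkRight hV hZ hU).1 hC1
  have h1' := ae_of_ae_map hUZ.aemeasurable h1
  have h2 := condExp_ae_eq_integral_condDistrib hUZ hV.aemeasurable hf.stronglyMeasurable hfI
  have h3 := condExp_ae_eq_integral_condDistrib hU hV.aemeasurable hf.stronglyMeasurable hfI
  have hm := hUZ.comap_le
  have hint : Integrable (fun ω => q (Z ω) * f (V ω)) P := hqL.integrable_mul hfL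
  have hqm : StronglyMeasurable[MeasurableSpace.comap (fun ω => (U ω, Z ω)) inferInstance]
      (fun ω => q (Z ω)) := by
    have : Measurable[MeasurableSpace.comap (fun ω => (U ω, Z ω)) inferInstance]
        (fun ω => q (Z ω)) :=
      (hq.comp measurable_snd).comp (comap_measurable (fun ω => (U ω, Z ω)))
    exact this.stronglyMeasurable
  have h4 := condExp_mul_of_stronglyMeasurable_left hqm hint hfI
  rw [← integral_condExp hm]
  refine integral_congr_ae ?_
  filter_upwards [h1', h2, h3, h4, hg] with ω a1 a2 a3 a4 a5
  have e : P[(fun ω => q (Z ω) * f (V ω)) | MeasurableSpace.comap (fun ω => (U ω, Z ω)) inferInstance] ω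
    = q (Z ω) * P[(fun ω => f (V ω)) | MeasurableSpace.comap (fun ω => (U ω, Z ω)) inferInstance] ω := a4
  rw [e, a2, a1, ← a5, a3]
  rfl

/-- **Asymptotic doubly robust identification.** Under Conditions (C1) and (C4), if either `h`
is an outcome confounding bridge at every period, or `q̃` satisfies the asymptotic treatment
confounding bridge condition (C10), then the doubly robust discrepancy `D_T` converges to `0`. -/
theorem asymptotic_doubly_robust_identification
    {Ω 𝒰 𝒲 𝒵 : Type*}
    [MeasurableSpace Ω] [StandardBorelSpace Ω] [Nonempty Ω]
    [MeasurableSpace 𝒰] [StandardBorelSpace 𝒰]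
    [MeasurableSpace 𝒲] [StandardBorelSpace 𝒲] [Nonempty 𝒲]
    [MeasurableSpace 𝒵] [StandardBorelSpace 𝒵]
    (P : Measure Ω) [IsProbabilityMeasure P]
    (U : ℕ → Ω → 𝒰) (W : ℕ → Ω → 𝒲) (Z : ℕ → Ω → 𝒵) (Y : ℕ → Ω → ℝ)
    (hU : ∀ t, Measurable (U t)) (hW : ∀ t, Measurable (W t))
    (hZ : ∀ t, Measurable (Z t)) (hY : ∀ t, Measurable (Y t))
    -- the pre-treatment horizon T₀(T) and its asymptotic fraction γ
    (T₀ : ℕ → ℕ) (hT₀ : ∀ T, 2 ≤ T → 1 ≤ T₀ T ∧ T₀ T < T)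
    (γ : ℝ) (hγ : 0 < γ ∧ γ < 1)
    (hT₀γ : Tendsto (fun T : ℕ => (T₀ T : ℝ) / T) atTop (nhds γ))
    -- importance weights ℓ_T over post-treatment periods
    (ℓ : ℕ → ℕ → ℝ)
    (hℓ_nonneg : ∀ T, 2 ≤ T → ∀ t ∈ Finset.Icc (T₀ T + 1) T, 0 ≤ ℓ T t)
    (hℓ_sum : ∀ T, 2 ≤ T → ∑ t ∈ Finset.Icc (T₀ T + 1) T, ℓ T t = 1)
    -- Condition (C1): for every period, Z_t ⫫ (Y_t, W_t) | σ(U_t)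
    (hC1 : ∀ t, CondIndepFun (MeasurableSpace.comap (U t) inferInstance) ((hU t).comap_le)
        (Z t) (fun ω => (Y t ω, W t ω)) P)
    -- Condition (C4): covariate shift via a common Markov kernel κ
    (κ : Kernel 𝒰 (ℝ × 𝒲)) [IsMarkovKernel κ]
    (hC4 : ∀ t, ∀ᵐ u ∂(P.map (U t)),
      condDistrib (fun ω => (Y t ω, W t ω)) (U t) P u = κ u)
    (h : 𝒲 → ℝ) (hh : Measurable h)
    (qt : 𝒵 → ℝ) (hqt : Measurable qt)
    (hqtL2 : ∀ t, MemLp (fun ω => qt (Z t ω)) 2 P)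
    (hYhL2 : ∀ t, MemLp (fun ω => Y t ω - h (W t ω)) 2 P)
    (hhW : ∀ t, Integrable (fun ω => h (W t ω)) P)
    (hYInt : ∀ t, Integrable (Y t) P)
    -- either (i) h is an outcome confounding bridge at every period, or (ii) q̃ satisfies (C10)
    (hDR : (∀ t, P[(fun ω => h (W t ω)) | MeasurableSpace.comap (U t) inferInstance]
        =ᵐ[P] P[Y t | MeasurableSpace.comap (U t) inferInstance]) ∨
      (∀ g : 𝒰 → ℝ, Measurable g → (∀ t, MemLp (fun ω => g (U t ω)) 2 P) →
        ∃ L : ℝ,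
          Tendsto (fun T => (1 / (T₀ T : ℝ)) *
              ∑ t ∈ Finset.Icc 1 (T₀ T), ∫ ω, qt (Z t ω) * g (U t ω) ∂P) atTop (nhds L) ∧
          Tendsto (fun T => ∑ t ∈ Finset.Icc (T₀ T + 1) T, ℓ T t * ∫ ω, g (U t ω) ∂P)
            atTop (nhds L))) :
    Tendsto (fun T =>
        ∑ t ∈ Finset.Icc (T₀ T + 1) T, ℓ T t * ∫ ω, Y t ω ∂P
          - ((1 / (T₀ T : ℝ)) *
              ∑ t ∈ Finset.Icc 1 (T₀ T), ∫ ω, qt (Z t ω) * (Y t ω - h (W t ω)) ∂P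
            + ∑ t ∈ Finset.Icc (T₀ T + 1) T, ℓ T t * ∫ ω, h (W t ω) ∂P))
      atTop (nhds 0) := by
  have hfm : Measurable (fun p : ℝ × 𝒲 => p.1 - h p.2) :=
    measurable_fst.sub (hh.comp measurable_snd)
  have hV : ∀ t, Measurable (fun ω => (Y t ω, W t ω)) := fun t => (hY t).prodMk (hW t)
  have hdiff : ∀ T, (∑ t ∈ Finset.Icc (T₀ T + 1) T, ℓ T t * ∫ ω, Y t ω ∂P)
      - ∑ t ∈ Finset.Icc (T₀ T + 1) T, ℓ T t * ∫ ω, h (W t ω) ∂P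
      = ∑ t ∈ Finset.Icc (T₀ T + 1) T, ℓ T t * ∫ ω, (Y t ω - h (W t ω)) ∂P := by
    intro T
    rw [← Finset.sum_sub_distrib]
    refine Finset.sum_congr rfl fun t _ => ?_
    rw [integral_sub (hYInt t) (hhW t)]
    ring
  -- it suffices to have a common `g`
  have key : ∀ g : 𝒰 → ℝ,
      (∀ t, P[(fun ω => Y t ω - h (W t ω)) | MeasurableSpace.comap (U t) inferInstance]
        =ᵐ[P] fun ω => g (U t ω)) → ∀ t,
      (∫ ω, qt (Z t ω) * (Y t ω - h (W t ω)) ∂P = ∫ ω, qt (Z t ω) * g (U t ω) ∂P) ∧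
      (∫ ω, (Y t ω - h (W t ω)) ∂P = ∫ ω, g (U t ω) ∂P) := by
    intro g hg t
    refine ⟨bridge_aux P (U t) (fun ω => (Y t ω, W t ω)) (Z t) (hU t) (hV t) (hZ t) (hC1 t)
      (fun p => p.1 - h p.2) hfm qt hqt (hqtL2 t) (hYhL2 t) g (hg t), ?_⟩
    rw [← integral_condExp (hU t).comap_le]
    exact integral_congr_ae (hg t)
  have fin : ∀ g : 𝒰 → ℝ,
      (∀ t, P[(fun ω => Y t ω - h (W t ω)) | MeasurableSpace.comap (U t) inferInstance]
        =ᵐ[P] fun ω => g (U t ω)) →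
      (fun T => ∑ t ∈ Finset.Icc (T₀ T + 1) T, ℓ T t * ∫ ω, Y t ω ∂P
          - ((1 / (T₀ T : ℝ)) *
              ∑ t ∈ Finset.Icc 1 (T₀ T), ∫ ω, qt (Z t ω) * (Y t ω - h (W t ω)) ∂P
            + ∑ t ∈ Finset.Icc (T₀ T + 1) T, ℓ T t * ∫ ω, h (W t ω) ∂P))
      = fun T => (∑ t ∈ Finset.Icc (T₀ T + 1) T, ℓ T t * ∫ ω, g (U t ω) ∂P)
          - (1 / (T₀ T : ℝ)) *
              ∑ t ∈ Finset.Icc 1 (T₀ T), ∫ ω, qt (Z t ω) * g (U t ω) ∂P := by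
    intro g hg
    funext T
    have e := hdiff T
    simp only [(key g hg _).1, (key g hg _).2] at e ⊢
    linarith
  rcases hDR with hi | hii
  · have hg : ∀ t, P[(fun ω => Y t ω - h (W t ω)) | MeasurableSpace.comap (U t) inferInstance]
        =ᵐ[P] fun ω => (fun _ : 𝒰 => (0 : ℝ)) (U t ω) := by
      intro t
      have e := condExp_sub (hYInt t) (hhW t) (MeasurableSpace.comap (U t) inferInstance)
      refine EventuallyEq.trans e ?_
      filter_upwards [hi t] with ω hω
      simp [hω]
    rw [fin (fun _ : 𝒰 => (0 : ℝ)) hg]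
    simp
  · let g : 𝒰 → ℝ := fun u => ∫ p, (p.1 - h p.2) ∂(κ u)
    have hgm : Measurable g :=
      (hfm.stronglyMeasurable.integral_kernel (κ := κ)).measurable
    have hg : ∀ t, P[(fun ω => Y t ω - h (W t ω)) | MeasurableSpace.comap (U t) inferInstance]
        =ᵐ[P] fun ω => g (U t ω) := by
      intro t
      have e := condExp_ae_eq_integral_condDistrib (hU t) (hV t).aemeasurable
        hfm.stronglyMeasurable ((hYhL2 t).integrable (by norm_num))
      refine EventuallyEq.trans e ?_
      filter_upwards [ae_of_ae_map (hU t).aemeasurable (hC4 t)] with ω hω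
      simp only [hω, g]
    have hgL : ∀ t, MemLp (fun ω => g (U t ω)) 2 P := fun t =>
      (memLp_congr_ae (hg t)).1 ((hYhL2 t).condExp (by norm_num))
    obtain ⟨L, h1, h2⟩ := hii g hgm hgL
    rw [fin g hg]
    simpa using h2.sub h1
end

section
/- (Gaussian treatment confounding bridge, Example 1.) Let σ₋, σ₊, σ > 0 and a ≠ 0 be real numbers such that c := a²/σ² − 1/σ₊² + 1/σ₋² > 0, and set β := (1/σ²)·(1/σ₋² − 1/σ₊²) / (2c). Then there exists α ∈ ℝ such that for every u ∈ ℝ the function z ↦ exp(α + β z²) is integrable with respect to the Gaussian measure N(a·u, σ²) and ∫ exp(α + β z²) dN(a·u, σ²)(z) = (σ₋/σ₊) · exp( u²/(2σ₋²) − u²/(2σ₊²) ); the right-hand side is the density of N(0, σ₊²) with respect to N(0, σ₋²) at u, so z ↦ exp(α + β z²) is a treatment confounding bridge function when U₋ ∼ N(0, σ₋²), U₊ ∼ N(0, σ₊²) and Z | U = u ∼ N(a u, σ²). -/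
open MeasureTheory ProbabilityTheory Real

/-- **Gaussian treatment confounding bridge (Example 1).** If
`c = a²/σ² − 1/σ₊² + 1/σ₋² > 0` and `β = σ⁻²(1/σ₋² − 1/σ₊²)/(2c)`, then for some `α ∈ ℝ` the
function `z ↦ exp(α + β z²)` integrates, under `N(a u, σ²)`, to the density
`(σ₋/σ₊) exp(u²/(2σ₋²) − u²/(2σ₊²))` of `N(0, σ₊²)` with respect to `N(0, σ₋²)` at `u`, for
every `u`; i.e. it is a treatment confounding bridge function. -/
theorem gaussian_treatment_bridge
    (σm σp σ a : ℝ) (hσm : 0 < σm) (hσp : 0 < σp) (hσ : 0 < σ) (ha : a ≠ 0)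
    (c : ℝ) (hc : c = a ^ 2 / σ ^ 2 - 1 / σp ^ 2 + 1 / σm ^ 2) (hcpos : 0 < c)
    (β : ℝ) (hβ : β = (1 / σ ^ 2) * (1 / σm ^ 2 - 1 / σp ^ 2) / (2 * c)) :
    ∃ α : ℝ, ∀ u : ℝ,
      Integrable (fun z => Real.exp (α + β * z ^ 2))
        (gaussianReal (a * u) ⟨σ ^ 2, sq_nonneg σ⟩) ∧
      ∫ z, Real.exp (α + β * z ^ 2) ∂(gaussianReal (a * u) ⟨σ ^ 2, sq_nonneg σ⟩)
        = (σm / σp) * Real.exp (u ^ 2 / (2 * σm ^ 2) - u ^ 2 / (2 * σp ^ 2)) := by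
  have hd : ∃ d, d = 1 / σm ^ 2 - 1 / σp ^ 2 := ⟨_, rfl⟩
  obtain ⟨d, hd⟩ := hd
  rw [← hd] at hβ
  have hc' : c * σ ^ 2 = a ^ 2 + d * σ ^ 2 := by
    rw [hc, hd]; field_simp; ring
  obtain ⟨p, hp⟩ : ∃ p, p = a ^ 2 / (2 * c * σ ^ 4) := ⟨_, rfl⟩
  have hppos : 0 < p := by rw [hp]; positivity
  have hv : (⟨σ ^ 2, sq_nonneg σ⟩ : NNReal) ≠ 0 := by
    intro h
    have := congrArg NNReal.toReal h
    have h2 : σ ^ 2 = 0 := this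
    have : 0 < σ ^ 2 := by positivity
    linarith
  obtain ⟨A, hA⟩ : ∃ A, A = (√(2 * π * σ ^ 2))⁻¹ := ⟨_, rfl⟩
  have hApos : 0 < A := by rw [hA]; positivity
  have hBpos : 0 < √(π / p) := by positivity
  have hKpos : 0 < (σm / σp) / (A * √(π / p)) := by positivity
  refine ⟨Real.log ((σm / σp) / (A * √(π / p))), fun u => ?_⟩
  have key : ∫ z, Real.exp (Real.log ((σm / σp) / (A * √(π / p))) + β * z ^ 2)
        ∂(gaussianReal (a * u) ⟨σ ^ 2, sq_nonneg σ⟩)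
        = (σm / σp) * Real.exp (u ^ 2 / (2 * σm ^ 2) - u ^ 2 / (2 * σp ^ 2)) := by
    rw [integral_gaussianReal_eq_integral_smul hv]
    have hpt : ∀ z : ℝ, gaussianPDFReal (a * u) ⟨σ ^ 2, sq_nonneg σ⟩ z •
        Real.exp (Real.log ((σm / σp) / (A * √(π / p))) + β * z ^ 2)
        = (A * ((σm / σp) / (A * √(π / p))) * Real.exp (d * u ^ 2 / 2)) *
          Real.exp (-p * (z - c * σ ^ 2 * u / a) ^ 2) := by
      intro z
      have e : -(z - a * u) ^ 2 / (2 * σ ^ 2) + β * z ^ 2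
          = d * u ^ 2 / 2 + -p * (z - c * σ ^ 2 * u / a) ^ 2 := by
        have hdd : d = c - a ^ 2 / σ ^ 2 := by
          field_simp; linarith
        rw [hβ, hp, hdd]
        field_simp
        ring
      change (√(2 * π * σ ^ 2))⁻¹ * Real.exp (-(z - a * u) ^ 2 / (2 * σ ^ 2)) *
        Real.exp (Real.log ((σm / σp) / (A * √(π / p))) + β * z ^ 2) = _
      rw [Real.exp_add, Real.exp_log hKpos, ← hA]
      have e2 := congrArg Real.exp e
      rw [Real.exp_add, Real.exp_add] at e2
      linear_combination (A * ((σm / σp) / (A * √(π / p)))) * e2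
    simp_rw [hpt]
    rw [integral_const_mul,
      integral_sub_right_eq_self (μ := volume) (fun z => Real.exp (-p * z ^ 2)),
      integral_gaussian]
    have e3 : u ^ 2 / (2 * σm ^ 2) - u ^ 2 / (2 * σp ^ 2) = d * u ^ 2 / 2 := by
      rw [hd]; field_simp
    rw [e3]
    generalize √(π / p) = B at *
    field_simp
  refine ⟨?_, key⟩
  by_contra h
  rw [integral_undef h] at key
  have : 0 < (σm / σp) * Real.exp (u ^ 2 / (2 * σm ^ 2) - u ^ 2 / (2 * σp ^ 2)) := by positivity
  linarith
end

section
/- (Poisson–exponential treatment confounding bridge, Example 2, one coordinate.) Let 0 < λ₋ ≤ λ₊, α ≥ 0, and β > max(0, λ₊ − λ₋). Then there exist real numbers a and b such that for every u ≥ 0, ∑_{n=0}^{∞} exp(a + b·n) · exp(−(α + β u)) · (α + β u)ⁿ / n! = (λ₊/λ₋) · exp((λ₋ − λ₊)·u); the right-hand side is the density of the Exponential(λ₊) law with respect to the Exponential(λ₋) law at u, so z ↦ exp(a + b z) is a treatment confounding bridge function when U₋ ∼ Exponential(λ₋), U₊ ∼ Exponential(λ₊) and Z | U = u ∼ Poisson(α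 + β u). -/
open Real

/-- **Poisson–exponential treatment confounding bridge (Example 2, one coordinate).**
If `0 < λ₋ ≤ λ₊`, `α ≥ 0` and `β > max 0 (λ₊ − λ₋)`, then there are reals `a, b` so that for
every `u ≥ 0` the expectation of `exp(a + b·Z)` under `Z ∼ Poisson(α + β u)` equals
`(λ₊/λ₋)·exp((λ₋ − λ₊) u)`, the density of `Exponential(λ₊)` with respect to
`Exponential(λ₋)` at `u`; i.e. `z ↦ exp(a + b z)` is a treatment confounding bridge. -/
theorem poisson_exponential_treatment_bridge
    (lm lp α β : ℝ) (hlm : 0 < lm) (hle : lm ≤ lp) (hα : 0 ≤ α)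
    (hβ : max 0 (lp - lm) < β) :
    ∃ a b : ℝ, ∀ u : ℝ, 0 ≤ u →
      ∑' n : ℕ, Real.exp (a + b * n) * Real.exp (-(α + β * u)) * (α + β * u) ^ n / n.factorial
        = (lp / lm) * Real.exp ((lm - lp) * u) := by
  have hb0 : 0 < β := lt_of_le_of_lt (le_max_left _ _) hβ
  have hb1 : lp - lm < β := lt_of_le_of_lt (le_max_right _ _) hβ
  have hc : 0 < 1 - (lp - lm) / β := by
    have : (lp - lm) / β < 1 := (div_lt_one hb0).2 hb1
    linarith
  have hr : 0 < lp / lm := div_pos (lt_of_lt_of_le hlm hle) hlm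
  refine ⟨Real.log (lp / lm) + α * (lp - lm) / β, Real.log (1 - (lp - lm) / β), ?_⟩
  intro u _
  set c := 1 - (lp - lm) / β with hcdef
  set a := Real.log (lp / lm) + α * (lp - lm) / β with ha
  have key : ∀ n : ℕ, Real.exp (a + Real.log c * n) * Real.exp (-(α + β * u)) * (α + β * u) ^ n
      / n.factorial = Real.exp (a + -(α + β * u)) * ((c * (α + β * u)) ^ n / n.factorial) := by
    intro n
    rw [Real.exp_add a (Real.log c * n), Real.exp_add a (-(α + β * u)), mul_comm (Real.log c), Real.exp_nat_mul, Real.exp_log hc,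
      mul_pow]
    ring
  have hs : HasSum (fun n : ℕ => (c * (α + β * u)) ^ n / n.factorial)
      (Real.exp (c * (α + β * u))) := by
    rw [Real.exp_eq_exp_ℝ]
    exact NormedSpace.expSeries_div_hasSum_exp _
  simp_rw [key]
  rw [(hs.mul_left _).tsum_eq, ← Real.exp_add]
  have : a + -(α + β * u) + c * (α + β * u) = Real.log (lp / lm) + (lm - lp) * u := by
    rw [ha, hcdef]
    field_simp
    ring
  rw [this, Real.exp_add, Real.exp_log hr]
end

section
/- (Identification with covariates via weighting.) Under Conditions (C1'), (C4') and (C6'), for every measurable f : ℝ → ℝ with f∘Y₋ ∈ L²(P) and f∘Y₊ ∈ L¹(P), one has E[f(Y₊)] = E[q*(Z₋, X₋) · f(Y₋)]. In particular (taking f the identity), E[Y₊] = E[q*(Z₋, X₋) · Y₋]. -/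
open MeasureTheory ProbabilityTheory MeasurableSpace

/-- **Identification with covariates via weighting.** Under Conditions (C1'), (C4') and (C6'),
for every square-integrable transform `f`, `E[f(Y₊)] = E[q*(Z₋, X₋) f(Y₋)]`. -/
theorem identification_with_covariates_via_weighting
    {Ω 𝒰 𝒲 𝒵 𝒳 : Type*}
    [MeasurableSpace Ω] [StandardBorelSpace Ω] [Nonempty Ω]
    [MeasurableSpace 𝒰] [StandardBorelSpace 𝒰]
    [MeasurableSpace 𝒲] [StandardBorelSpace 𝒲] [Nonempty 𝒲]
    [MeasurableSpace 𝒵] [StandardBorelSpace 𝒵]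
    [MeasurableSpace 𝒳] [StandardBorelSpace 𝒳]
    (P : Measure Ω) [IsProbabilityMeasure P]
    (Um Up : Ω → 𝒰) (Xm Xp : Ω → 𝒳) (Wm Wp : Ω → 𝒲) (Zm : Ω → 𝒵) (Ym Yp : Ω → ℝ)
    (hUm : Measurable Um) (hUp : Measurable Up)
    (hXm : Measurable Xm) (hXp : Measurable Xp)
    (hWm : Measurable Wm) (hWp : Measurable Wp)
    (hZm : Measurable Zm) (hYm : Measurable Ym) (hYp : Measurable Yp)
    -- Condition (C1'): Z₋ ⫫ (Y₋, W₋) | σ(X₋, U₋)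
    (hC1 : CondIndepFun (MeasurableSpace.comap (fun ω => (Xm ω, Um ω)) inferInstance)
      ((hXm.prodMk hUm).comap_le) Zm (fun ω => (Ym ω, Wm ω)) P)
    -- Condition (C4'): covariate shift given (X, U)
    (hC4 : ∀ᵐ xu ∂(P.map (fun ω => (Xm ω, Um ω))),
      condDistrib (fun ω => (Ym ω, Wm ω)) (fun ω => (Xm ω, Um ω)) P xu
        = condDistrib (fun ω => (Yp ω, Wp ω)) (fun ω => (Xp ω, Up ω)) P xu)
    -- Condition (C6'): treatment confounding bridge with covariates
    (habs : P.map (fun ω => (Xp ω, Up ω)) ≪ P.map (fun ω => (Xm ω, Um ω)))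
    (qstar : 𝒵 × 𝒳 → ℝ) (hqstar : Measurable qstar)
    (hqL2 : MemLp (fun ω => qstar (Zm ω, Xm ω)) 2 P)
    (hbridge : P[(fun ω => qstar (Zm ω, Xm ω)) |
        MeasurableSpace.comap (fun ω => (Xm ω, Um ω)) inferInstance]
      =ᵐ[P] fun ω => ((P.map (fun ω' => (Xp ω', Up ω'))).rnDeriv
        (P.map (fun ω' => (Xm ω', Um ω'))) (Xm ω, Um ω)).toReal)
    (f : ℝ → ℝ) (hf : Measurable f)
    (hfYm : MemLp (fun ω => f (Ym ω)) 2 P)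
    (hfYp : Integrable (fun ω => f (Yp ω)) P) :
    ∫ ω, f (Yp ω) ∂P = ∫ ω, qstar (Zm ω, Xm ω) * f (Ym ω) ∂P := by
  have hK : Measurable (fun ω => (Xm ω, Um ω)) := hXm.prodMk hUm
  have hKp : Measurable (fun ω => (Xp ω, Up ω)) := hXp.prodMk hUp
  have hV : Measurable (fun ω => (Ym ω, Wm ω)) := hYm.prodMk hWm
  have hVp : Measurable (fun ω => (Yp ω, Wp ω)) := hYp.prodMk hWp
  have : Nonempty 𝒵 := ⟨Zm (Classical.arbitrary Ω)⟩
  have hg : StronglyMeasurable (fun v : ℝ × 𝒲 => f v.1) :=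
    (hf.comp measurable_fst).stronglyMeasurable
  have hCI := (condIndepFun_iff_condDistrib_prod_ae_eq_prodMkRight hV hZm hK).1 hC1
  set K : Ω → 𝒳 × 𝒰 := fun ω => (Xm ω, Um ω) with hKdef
  set Kp : Ω → 𝒳 × 𝒰 := fun ω => (Xp ω, Up ω) with hKpdef
  set V : Ω → ℝ × 𝒲 := fun ω => (Ym ω, Wm ω) with hVdef
  set Vp : Ω → ℝ × 𝒲 := fun ω => (Yp ω, Wp ω) with hVpdef
  set h : 𝒳 × 𝒰 → ℝ := fun k => ∫ v, f v.1 ∂condDistrib V K P k with hh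
  have hhm : StronglyMeasurable h := by
    have : StronglyMeasurable (fun p : (𝒳 × 𝒰) × (ℝ × 𝒲) => f p.2.1) :=
      (hf.comp (measurable_fst.comp measurable_snd)).stronglyMeasurable
    exact this.integral_condDistrib (Y := V) (X := K) (μ := P)
  have hKZ : Measurable (fun ω => (K ω, Zm ω)) := hK.prodMk hZm
  have hfi : Integrable (fun ω => f (Ym ω)) P := hfYm.integrable (by norm_num)
  have hqi : Integrable (fun ω => qstar (Zm ω, Xm ω)) P := hqL2.integrable (by norm_num)
  have hqf : Integrable ((fun ω => qstar (Zm ω, Xm ω)) * fun ω => f (Ym ω)) P :=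
    hqL2.integrable_mul hfYm
  have h1 : P[(fun ω => f (Ym ω)) | MeasurableSpace.comap (fun ω => (K ω, Zm ω)) inferInstance]
      =ᵐ[P] fun ω => h (K ω) := by
    have e1 := condExp_ae_eq_integral_condDistrib (μ := P) hKZ hV.aemeasurable hg hfi
    refine e1.trans ?_
    filter_upwards [ae_of_ae_map hKZ.aemeasurable hCI] with ω hω
    rw [hω, hh]
    simp [Kernel.prodMkRight_apply]
  have hqsm : StronglyMeasurable[MeasurableSpace.comap (fun ω => (K ω, Zm ω)) inferInstance]
      (fun ω => qstar (Zm ω, Xm ω)) := by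
    have : Measurable (fun p : (𝒳 × 𝒰) × 𝒵 => qstar (p.2, p.1.1)) := by fun_prop
    exact (this.comp (comap_measurable (fun ω => (K ω, Zm ω)))).stronglyMeasurable
  have h2 : P[((fun ω => qstar (Zm ω, Xm ω)) * fun ω => f (Ym ω)) |
      MeasurableSpace.comap (fun ω => (K ω, Zm ω)) inferInstance]
      =ᵐ[P] (fun ω => qstar (Zm ω, Xm ω)) * fun ω => h (K ω) :=
    (condExp_mul_of_stronglyMeasurable_left hqsm hqf hfi).trans
      (Filter.EventuallyEq.rfl.mul h1)
  have hqh : Integrable ((fun ω => qstar (Zm ω, Xm ω)) * fun ω => h (K ω)) P :=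
    integrable_condExp.congr h2
  have hhK : StronglyMeasurable[MeasurableSpace.comap K inferInstance] (fun ω => h (K ω)) :=
    hhm.comp_measurable (comap_measurable K)
  have h3 := (condExp_mul_of_stronglyMeasurable_right hhK hqh hqi).trans
    (hbridge.mul Filter.EventuallyEq.rfl)
  have R : ∫ ω, qstar (Zm ω, Xm ω) * f (Ym ω) ∂P = ∫ k, h k ∂(P.map Kp) := by
    calc ∫ ω, qstar (Zm ω, Xm ω) * f (Ym ω) ∂P
        = ∫ ω, ((fun ω => qstar (Zm ω, Xm ω)) * fun ω => h (K ω)) ω ∂P := by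
          rw [← integral_congr_ae h2, integral_condExp hKZ.comap_le]; rfl
      _ = ∫ ω, ((P.map Kp).rnDeriv (P.map K) (K ω)).toReal * h (K ω) ∂P := by
          rw [← integral_condExp hK.comap_le, integral_congr_ae h3]; rfl
      _ = ∫ k, ((P.map Kp).rnDeriv (P.map K) k).toReal * h k ∂(P.map K) := by
          rw [integral_map hK.aemeasurable]
          exact ((Measure.measurable_rnDeriv _ _).ennreal_toReal.mul
            hhm.measurable).aestronglyMeasurable
      _ = _ := integral_toReal_rnDeriv_mul habs
  rw [R]
  have h4 : ∫ k, h k ∂(P.map Kp) = ∫ k, ∫ v, f v.1 ∂condDistrib Vp Kp P k ∂(P.map Kp) := by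
    refine integral_congr_ae ?_
    filter_upwards [habs.ae_le hC4] with k hk
    rw [hh]
    simp only [hk]
  have h5 := condExp_ae_eq_integral_condDistrib (μ := P) hKp hVp.aemeasurable hg hfYp
  rw [h4, integral_map hKp.aemeasurable, ← integral_congr_ae h5, integral_condExp hKp.comap_le]
  have : StronglyMeasurable (fun p : (𝒳 × 𝒰) × (ℝ × 𝒲) => f p.2.1) :=
    (hf.comp (measurable_fst.comp measurable_snd)).stronglyMeasurable
  exact (this.integral_condDistrib (Y := Vp) (X := Kp) (μ := P)).aestronglyMeasurable
end
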